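/- Let G be a simple graph on [n] with no isolated vertices and edge ideal I. If index(I) = projdim(I) = t (finite), then n = t + 3 and beta_{t,t+3}(I) = 1. -/

import Mathlib

open MvPolynomial

noncomputable section

abbrev SRing (K : Type) [Field K] (n : ℕ) := MvPolynomial (Fin n) K

/-- total degree of an exponent vector -/
def mdeg {n : ℕ} (e : Fin n →₀ ℕ) : ℕ := e.sum fun _ v => v

/-- minimal monomial generators of a monomial ideal, as exponent vectors:
monomials in `J` none of whose proper divisors lies in `J` -/
def minGen {K : Type} [Field K] {n : ℕ} (J : Ideal (SRing K n)) : Set (Fin n →₀ ℕ) :=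
  {e | (monomial e (1:K)) ∈ J ∧
    ∀ e' : Fin n →₀ ℕ, e' ≤ e → e' ≠ e → (monomial e' (1:K)) ∉ J}

/-- adjacency in the graph `G_J^{(u,v)}` : vertices are the minimal generators of `J`
dividing `lcm(u,v)`, with an edge between two of them iff their lcm has degree `d+1` -/
def lcmGraphAdj {K : Type} [Field K] {n : ℕ} (J : Ideal (SRing K n)) (d : ℕ)
    (u v : Fin n →₀ ℕ) (w w' : Fin n →₀ ℕ) : Prop :=
  w ∈ minGen J ∧ w' ∈ minGen J ∧ w ≤ u ⊔ v ∧ w' ≤ u ⊔ v ∧ mdeg (w ⊔ w') = d + 1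

/-- a graded partial free resolution of the ideal `I`, exact at homological positions `< r`:
`F_i` is free with basis in (internal) degrees `dg i`, the maps are graded of degree `0`,
`F_0` surjects onto `I`, and the sequence is exact at `F_i` for `i < r`. -/
structure GradedPartialRes {K : Type} [Field K] {n : ℕ} (I : Ideal (SRing K n)) (r : ℕ∞) where
  s : ℕ → ℕ
  dg : ∀ i, Fin (s i) → ℕ
  aug : (Fin (s 0) →₀ SRing K n) →ₗ[SRing K n] SRing K n
  diff : ∀ i, (Fin (s (i+1)) →₀ SRing K n) →ₗ[SRing K n] (Fin (s i) →₀ SRing K n)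
  aug_hom : ∀ k, (aug (Finsupp.single k 1)).IsHomogeneous (dg 0 k)
  diff_hom : ∀ i k l, (diff i (Finsupp.single k 1)) l = 0 ∨
      ∃ m, ((diff i (Finsupp.single k 1)) l).IsHomogeneous m ∧ dg i l + m = dg (i+1) k
  aug_range : LinearMap.range aug = I
  exact_zero : (0 : ℕ∞) < r → LinearMap.range (diff 0) = LinearMap.ker aug
  exact_succ : ∀ i : ℕ, ((i : ℕ∞) + 1) < r →
      LinearMap.range (diff (i+1)) = LinearMap.ker (diff i)

/-- the graded Betti number `β_{i,j}(I)`: the minimal number of degree-`j` basis elements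
in homological position `i`, over all graded partial resolutions of `I` exact at
positions `0, …, i` (the minimum is attained by the minimal graded free resolution). -/
def gradedBetti {K : Type} [Field K] {n : ℕ} (I : Ideal (SRing K n)) (i j : ℕ) : ℕ∞ :=
  ⨅ R : GradedPartialRes I ((i : ℕ∞)+1),
    ((Finset.univ.filter fun k => R.dg i k = j).card : ℕ∞)

/-- `I` (generated in degree `d`) is `r` steps linear: `β_{i,i+j}(I) = 0` for
all `i ≤ r` and `j > d` -/
def stepsLinear {K : Type} [Field K] {n : ℕ} (I : Ideal (SRing K n)) (d r : ℕ) : Prop :=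
  ∀ i ≤ r, ∀ j, d < j → gradedBetti I i (i+j) = 0

/-- `index(I) = sup{r : I is r steps linear} + 1` -/
def idealIndex {K : Type} [Field K] {n : ℕ} (I : Ideal (SRing K n)) (d : ℕ) : ℕ∞ :=
  sSup {x : ℕ∞ | ∃ r : ℕ, x = (r : ℕ∞) + 1 ∧ stepsLinear I d r}

/-- `I` is linearly related: all first syzygies are linear, i.e. `index(I) > 1` -/
def LinearlyRelated {K : Type} [Field K] {n : ℕ} (I : Ideal (SRing K n)) (d : ℕ) : Prop :=
  stepsLinear I d 1

/-- projective dimension of `I`: the minimal length of a graded free resolution of `I` -/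
def projDim {K : Type} [Field K] {n : ℕ} (I : Ideal (SRing K n)) : ℕ∞ :=
  sInf {x : ℕ∞ | ∃ m : ℕ, x = (m : ℕ∞) ∧
    ∃ R : GradedPartialRes I ⊤, ∀ i : ℕ, m < i → R.s i = 0}

/-- the edge ideal of the graph (possibly with loops) given by a symmetric relation `E`:
generated by the monomials `X i * X j` with `E i j` -/
def edgeIdeal (K : Type) [Field K] {n : ℕ} (E : Fin n → Fin n → Prop) : Ideal (SRing K n) :=
  Ideal.span {p | ∃ i j, E i j ∧ p = X i * X j}

/-- `E` is gap free: for any two disjoint edges there is an edge meeting both -/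
def GapFree {n : ℕ} (E : Fin n → Fin n → Prop) : Prop :=
  ∀ i i' j j', E i i' → E j j' → i ≠ j → i ≠ j' → i' ≠ j → i' ≠ j' →
    ∃ a b, E a b ∧ (a = i ∨ a = i') ∧ (b = j ∨ b = j')

/-- The sign of the variable `v` in the Koszul differential at the index set `T`. -/
def koszulSign {n : ℕ} (v : Fin n) (T : Finset (Fin n)) : ℤ := (-1) ^ (T.filter (· < v)).card

/-- The total Koszul differential on the variables of `SRing K n`, with coefficients in `M`;
the component indexed by `T` is the coefficient of the wedge of the `e_v` with `v ∈ T`. -/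
def koszulD {K : Type} [Field K] {n : ℕ} {M : Type} [AddCommGroup M] [Module (SRing K n) M]
    (κ : Finset (Fin n) → M) (T : Finset (Fin n)) : M :=
  ∑ v ∈ Tᶜ, koszulSign v T • ((X v : SRing K n) • κ (insert v T))

section Koszul

variable {K : Type} [Field K] {n : ℕ} {M N : Type} [AddCommGroup M] [Module (SRing K n) M]
  [AddCommGroup N] [Module (SRing K n) N]

lemma koszulSign_mul_self (v : Fin n) (T : Finset (Fin n)) :
    koszulSign v T * koszulSign v T = 1 := by
  unfold koszulSign
  rw [← pow_add, ← two_mul, pow_mul]; simp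

lemma koszulSign_insert_of_lt {u v : Fin n} {T : Finset (Fin n)} (hv : v ∉ T) (h : v < u) :
    koszulSign u (insert v T) = - koszulSign u T := by
  unfold koszulSign
  rw [Finset.filter_insert, if_pos h, Finset.card_insert_of_notMem (by simp [hv]), pow_succ]
  ring

lemma koszulSign_insert_of_not_lt {u v : Fin n} {T : Finset (Fin n)} (h : ¬ v < u) :
    koszulSign u (insert v T) = koszulSign u T := by
  unfold koszulSign
  rw [Finset.filter_insert, if_neg h]

lemma koszulSign_swap {u v : Fin n} {T : Finset (Fin n)} (hu : u ∉ T) (hv : v ∉ T) (huv : u ≠ v) :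
    koszulSign v T * koszulSign u (insert v T) = -(koszulSign u T * koszulSign v (insert u T)) := by
  rcases lt_or_gt_of_ne huv with h | h
  · rw [koszulSign_insert_of_not_lt h.not_gt, koszulSign_insert_of_lt hu h]; ring
  · rw [koszulSign_insert_of_lt hv h, koszulSign_insert_of_not_lt h.not_gt]; ring

lemma koszulD_map (f : M →ₗ[SRing K n] N) (κ : Finset (Fin n) → M) (T : Finset (Fin n)) :
    koszulD (K := K) (fun T => f (κ T)) T = f (koszulD (K := K) κ T) := by
  simp [koszulD, map_sum, map_zsmul]

lemma koszulD_sub (κ κ' : Finset (Fin n) → M) (T : Finset (Fin n)) :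
    koszulD (K := K) (fun T => κ T - κ' T) T = koszulD (K := K) κ T - koszulD (K := K) κ' T := by
  simp [koszulD, smul_sub, Finset.sum_sub_distrib]

lemma koszulD_koszulD (κ : Finset (Fin n) → M) (T : Finset (Fin n)) :
    koszulD (K := K) (koszulD (K := K) κ) T = 0 := by
  unfold koszulD
  simp only [Finset.smul_sum]
  rw [Finset.sum_sigma']
  refine Finset.sum_involution (fun p _ => ⟨p.2, p.1⟩) ?_ ?_ ?_ ?_
  · rintro ⟨v, u⟩ h
    simp only [Finset.mem_sigma, Finset.mem_compl, Finset.mem_insert, not_or] at h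
    obtain ⟨hv, huv, hu⟩ := h
    rw [Finset.insert_comm v u, smul_comm (X v) (koszulSign u _), smul_comm (X u) (koszulSign v _),
      smul_smul, smul_smul (koszulSign u T), koszulSign_swap hu hv huv, smul_comm (X v) (X u),
      neg_smul, neg_add_cancel]
  · rintro ⟨v, u⟩ h _ h'
    simp only [Finset.mem_sigma, Finset.mem_compl, Finset.mem_insert, not_or] at h
    simp only [Sigma.mk.injEq, heq_eq_eq] at h'
    exact h.2.1 h'.1
  · rintro ⟨v, u⟩ h
    simp only [Finset.mem_sigma, Finset.mem_compl, Finset.mem_insert, not_or] at h ⊢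
    exact ⟨h.2.2, fun e => h.2.1 e.symm, h.1⟩
  · rintro ⟨v, u⟩ h; rfl

lemma exists_coeff_ite (P : (Fin n →₀ ℕ) → Prop) [DecidablePred P] (f : SRing K n) :
    ∃ g : SRing K n, ∀ α, coeff α g = if P α then coeff α f else 0 := by
  refine ⟨∑ γ ∈ f.support.filter P, monomial γ (coeff γ f), fun α => ?_⟩
  rw [coeff_sum]
  simp only [coeff_monomial]
  rw [Finset.sum_ite_eq']
  by_cases hP : P α <;> by_cases hc : coeff α f = 0
  · rw [if_pos hP, hc, ite_self]
  · rw [if_pos hP, if_pos (Finset.mem_filter.2 ⟨mem_support_iff.2 hc, hP⟩)]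
  · rw [if_neg hP, hc, ite_self]
  · rw [if_neg hP, if_neg fun h => hP (Finset.mem_filter.1 h).2]

lemma coeff_koszulD (κ : Finset (Fin n) → SRing K n) (T : Finset (Fin n)) (α : Fin n →₀ ℕ) :
    coeff α (koszulD (K := K) κ T) = ∑ v ∈ Tᶜ, koszulSign v T •
      if α v = 0 then 0 else coeff (α - Finsupp.single v 1) (κ (insert v T)) := by
  unfold koszulD
  rw [coeff_sum]
  refine Finset.sum_congr rfl fun v _ => ?_
  rw [coeff_smul, smul_eq_mul, coeff_X_mul']
  simp only [Finsupp.mem_support_iff]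
  split_ifs <;> simp_all


lemma koszul_exact_ring (κ : Finset (Fin n) → SRing K n) (hd : ∀ T, koszulD (K := K) κ T = 0)
    (h0 : coeff 0 (κ ∅) = 0) :
    ∃ η : Finset (Fin n) → SRing K n, η ∅ = 0 ∧ ∀ T, κ T = koszulD (K := K) η T := by
  classical
  have hP : ∀ (v : Fin n) (f : SRing K n), ∃ g : SRing K n, ∀ α,
      coeff α g = if ∀ u < v, α u = 0 then coeff (α + Finsupp.single v 1) f else 0 := by
    intro v f
    obtain ⟨g, hg⟩ := exists_coeff_ite (fun α => ∀ u < v, α u = 0)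
      (f.divMonomial (Finsupp.single v 1))
    refine ⟨g, fun α => ?_⟩
    rw [hg, coeff_divMonomial, add_comm]
  choose P hP using hP
  let η : Finset (Fin n) → SRing K n := fun T =>
    if h : T.Nonempty then P (T.min' h) (κ (T.erase (T.min' h))) else 0
  have hη : ∀ T (v : Fin n) (α : Fin n →₀ ℕ), (∀ u < v, u ∉ T) → (∀ u < v, α u = 0) → v ∈ T →
      coeff α (η T) = coeff (α + Finsupp.single v 1) (κ (T.erase v)) := by
    intro T v α hT hα hv
    have hne : T.Nonempty := ⟨v, hv⟩
    have hmin : T.min' hne = v :=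
      le_antisymm (Finset.min'_le _ _ hv)
        (not_lt.1 fun h => hT _ h (Finset.min'_mem _ _))
    simp only [η, dif_pos hne, hmin, hP]
    rw [if_pos hα]
  have hη0 : ∀ T (v : Fin n) (α : Fin n →₀ ℕ), α v ≠ 0 → (∀ u < v, u ∉ T) → v ∉ T →
      coeff α (η T) = 0 := by
    intro T v α hα hT hv
    simp only [η]
    split_ifs with hne
    · rw [hP, if_neg]
      intro h
      have hm := Finset.min'_mem T hne
      rcases lt_trichotomy v (T.min' hne) with h1 | h1 | h1
      · exact hα (h v h1)
      · exact hv (h1 ▸ hm)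
      · exact hT _ h1 hm
    · exact coeff_zero _
  refine ⟨η, by simp [η], fun T => ?_⟩
  ext α
  rw [coeff_koszulD]
  by_cases hβ : T = ∅ ∧ α = 0
  · obtain ⟨rfl, rfl⟩ := hβ
    simp [h0]
  have hex : ((Finset.univ : Finset (Fin n)).filter fun v => v ∈ T ∨ α v ≠ 0).Nonempty := by
    by_contra hcon
    rw [Finset.not_nonempty_iff_eq_empty, Finset.filter_eq_empty_iff] at hcon
    apply hβ
    refine ⟨Finset.eq_empty_of_forall_notMem fun v hv => hcon (Finset.mem_univ v) (Or.inl hv), ?_⟩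
    ext v
    by_contra hv
    exact hcon (Finset.mem_univ v) (Or.inr hv)
  obtain ⟨v, hv, hvmin⟩ : ∃ v, (v ∈ T ∨ α v ≠ 0) ∧ ∀ u < v, u ∉ T ∧ α u = 0 := by
    refine ⟨Finset.min' _ hex, (Finset.mem_filter.1 (Finset.min'_mem _ hex)).2, fun u hu => ?_⟩
    by_contra hcon
    refine (Finset.min'_le _ u (Finset.mem_filter.2 ⟨Finset.mem_univ u, ?_⟩)).not_gt hu
    tauto
  by_cases hvT : v ∈ T
  · have hdT := congrArg (coeff (α + Finsupp.single v 1)) (hd (T.erase v))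
    have hvc : v ∈ (T.erase v)ᶜ := by simp
    have hT' : (T.erase v)ᶜ.erase v = Tᶜ := by
      ext u; simp only [Finset.mem_erase, Finset.mem_compl]
      by_cases h : u = v
      · simp [h, hvT]
      · simp [h]
    have hsgn : koszulSign v (T.erase v) = 1 := by
      unfold koszulSign
      rw [Finset.filter_eq_empty_iff.2, Finset.card_empty, pow_zero]
      intro u hu huv
      exact (hvmin u huv).1 (Finset.mem_of_mem_erase hu)
    rw [coeff_koszulD, coeff_zero, ← Finset.add_sum_erase _ _ hvc, hT', hsgn,
      Finset.insert_erase hvT] at hdT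
    simp only [Finsupp.add_apply, Finsupp.single_eq_same, Nat.add_eq_zero_iff, one_ne_zero,
      and_false, if_false, add_tsub_cancel_right, one_smul] at hdT
    rw [eq_neg_of_add_eq_zero_left hdT, ← Finset.sum_neg_distrib]
    refine Finset.sum_congr rfl fun u hu => ?_
    have huT : u ∉ T := Finset.mem_compl.1 hu
    have huv : u ≠ v := fun h => huT (h ▸ hvT)
    have hvu : v < u ∨ α u = 0 := by
      rcases lt_or_gt_of_ne huv with h | h
      · exact Or.inr (hvmin u h).2
      · exact Or.inl h
    have hsu : α u ≠ 0 → koszulSign u T = - koszulSign u (T.erase v) := by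
      intro h
      conv_lhs => rw [← Finset.insert_erase hvT]
      exact koszulSign_insert_of_lt (by simp) (hvu.resolve_right h)
    simp only [Finsupp.single_apply, huv.symm, if_false, and_true]
    by_cases hu0 : α u = 0
    · simp [hu0]
    · rw [if_neg hu0, if_neg hu0, hsu hu0, neg_smul,
        hη (insert u T) v _ ?_ ?_ (Finset.mem_insert_of_mem hvT), Finset.erase_insert_of_ne huv]
      · congr 3
        ext w
        simp only [Finsupp.coe_tsub, Finsupp.coe_add, Pi.sub_apply, Pi.add_apply,
          Finsupp.single_apply]
        split_ifs <;> omega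
      · intro w hw hmem
        rcases Finset.mem_insert.1 hmem with rfl | h
        · exact (hvu.resolve_right hu0).not_gt hw
        · exact (hvmin w hw).1 h
      · intro w hw
        simp [(hvmin w hw).2]
  · have hαv : α v ≠ 0 := hv.resolve_left hvT
    have hsgn : koszulSign v T = 1 := by
      unfold koszulSign
      rw [Finset.filter_eq_empty_iff.2, Finset.card_empty, pow_zero]
      exact fun u hu huv => (hvmin u huv).1 hu
    rw [Finset.sum_eq_single_of_mem v (Finset.mem_compl.2 hvT), hsgn, if_neg hαv, one_smul,
      hη (insert v T) v _ ?_ ?_ (Finset.mem_insert_self _ _), Finset.erase_insert hvT]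
    · congr 1
      ext w
      simp only [Finsupp.coe_tsub, Finsupp.coe_add, Pi.sub_apply, Pi.add_apply,
        Finsupp.single_apply]
      split_ifs with h
      · subst h; omega
      · omega
    · intro u hu hmem
      rcases Finset.mem_insert.1 hmem with rfl | h
      · exact hu.ne rfl
      · exact (hvmin u hu).1 h
    · intro u hu
      simp [(hvmin u hu).2]
    · intro u hu huv
      split_ifs with hu0
      · simp
      · rw [hη0 (insert u T) v, smul_zero]
        · simpa [Finsupp.single_apply, huv] using hαv
        · intro w hw hmem
          rcases Finset.mem_insert.1 hmem with rfl | h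
          · exact hu0 (hvmin w hw).2
          · exact (hvmin w hw).1 h
        · simp [huv.symm, hvT]

lemma koszulD_apply {s : ℕ} (κ : Finset (Fin n) → (Fin s →₀ SRing K n)) (T : Finset (Fin n))
    (l : Fin s) : koszulD (K := K) κ T l = koszulD (K := K) (fun T => κ T l) T :=
  (koszulD_map (Finsupp.lapply l) κ T).symm

lemma koszul_exact {s : ℕ} (κ : Finset (Fin n) → (Fin s →₀ SRing K n))
    (hd : ∀ T, koszulD (K := K) κ T = 0) (h0 : ∀ l, coeff 0 (κ ∅ l) = 0) :
    ∃ η : Finset (Fin n) → (Fin s →₀ SRing K n), η ∅ = 0 ∧ ∀ T, κ T = koszulD (K := K) η T := by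
  have h : ∀ l, ∃ η : Finset (Fin n) → SRing K n, η ∅ = 0 ∧
      ∀ T, κ T l = koszulD (K := K) η T := fun l =>
    koszul_exact_ring (fun T => κ T l)
      (fun T => by rw [← koszulD_apply, hd]; rfl) (h0 l)
  choose η hη0 hη using h
  refine ⟨fun T => Finsupp.equivFunOnFinite.symm fun l => η l T, ?_, fun T => ?_⟩
  · ext1 l; simp [hη0]
  · ext1 l
    rw [koszulD_apply, hη]
    rfl

end Koszul

section Grading

variable {K : Type} [Field K] {n : ℕ}

/-- The homogeneous elements of degree `d` of the free module of rank one generated in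
degree `c`. -/
def ringDeg (K : Type) [Field K] (n : ℕ) (c d : ℕ) : AddSubgroup (SRing K n) where
  carrier := {p | ∀ α, coeff α p ≠ 0 → c + α.degree = d}
  zero_mem' := fun α h => absurd (coeff_zero α) h
  add_mem' := by
    intro p q hp hq α h
    by_cases h' : coeff α p = 0
    · exact hq α fun h'' => h (by rw [coeff_add, h', h'', add_zero])
    · exact hp α h'
  neg_mem' := by
    intro p hp α h
    exact hp α fun h' => h (by rw [coeff_neg, h', neg_zero])

/-- The homogeneous elements of degree `d` of the free module with generators in
degrees `dg`. -/
def freeDeg {ι : Type} (dg : ι → ℕ) (d : ℕ) : AddSubgroup (ι →₀ SRing K n) where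
  carrier := {y | ∀ l, y l ∈ ringDeg K n (dg l) d}
  zero_mem' := fun _ => zero_mem _
  add_mem' := fun hp hq l => add_mem (hp l) (hq l)
  neg_mem' := fun hp l => neg_mem (hp l)

/-- Compatibility of a family of homogeneous parts with the grading of the polynomial ring. -/
def IsGrading (K : Type) [Field K] (n : ℕ) {V : Type} [AddCommGroup V] [Module (SRing K n) V]
    (H : ℕ → AddSubgroup V) : Prop :=
  ∀ (m d : ℕ) (p : SRing K n) (x : V), p ∈ ringDeg K n 0 m → x ∈ H d → p • x ∈ H (m + d)

lemma mem_ringDeg {c d : ℕ} {p : SRing K n} :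
    p ∈ ringDeg K n c d ↔ ∀ α, coeff α p ≠ 0 → c + α.degree = d := Iff.rfl

lemma mem_freeDeg {ι : Type} {dg : ι → ℕ} {d : ℕ} {y : ι →₀ SRing K n} :
    y ∈ freeDeg dg d ↔ ∀ l, y l ∈ ringDeg K n (dg l) d := Iff.rfl

lemma isHomogeneous_iff_mem_ringDeg {m : ℕ} {p : SRing K n} :
    p.IsHomogeneous m ↔ p ∈ ringDeg K n 0 m := by
  rw [mem_ringDeg]
  constructor
  · intro h α hα
    rw [zero_add]
    by_contra hne
    exact hα (h.coeff_eq_zero hne)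
  · intro h α hα
    have := h α hα
    rw [zero_add] at this
    rw [Finsupp.degree_eq_weight_one] at this
    exact this

lemma ringDeg_mul {c d m : ℕ} {p q : SRing K n} (hp : p ∈ ringDeg K n 0 m)
    (hq : q ∈ ringDeg K n c d) : p * q ∈ ringDeg K n c (m + d) := by
  classical
  intro α hα
  rw [coeff_mul] at hα
  obtain ⟨⟨a, b⟩, hab, h⟩ := Finset.exists_ne_zero_of_sum_ne_zero hα
  rw [Finset.HasAntidiagonal.mem_antidiagonal] at hab
  have h1 := hp a (left_ne_zero_of_mul h)
  have h2 := hq b (right_ne_zero_of_mul h)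
  rw [← hab, map_add]
  simp only at h1 h2 ⊢
  omega

lemma isGrading_ringDeg (c : ℕ) : IsGrading K n (ringDeg K n c) :=
  fun _ _ _ _ hp hx => ringDeg_mul hp hx

lemma isGrading_freeDeg {ι : Type} (dg : ι → ℕ) :
    IsGrading K n (freeDeg (K := K) (n := n) dg) :=
  fun _ _ _ _ hp hx l => ringDeg_mul hp (hx l)

lemma X_mem_ringDeg (v : Fin n) : (X v : SRing K n) ∈ ringDeg K n 0 1 :=
  isHomogeneous_iff_mem_ringDeg.1 (isHomogeneous_X K v)

lemma one_mem_ringDeg (c : ℕ) : (1 : SRing K n) ∈ ringDeg K n c c := by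
  intro α h
  rw [coeff_one] at h
  have : α = 0 := by
    by_contra hne
    exact h (if_neg fun h => hne h.symm)
  simp [this]

lemma single_mem_freeDeg {ι : Type} {dg : ι → ℕ} {l : ι} {d : ℕ} {p : SRing K n}
    (hp : p ∈ ringDeg K n (dg l) d) : Finsupp.single l p ∈ freeDeg dg d := by
  classical
  intro k
  rw [Finsupp.single_apply]
  split_ifs with h
  · exact h ▸ hp
  · exact zero_mem _

/-- A ring degree drop: an element of degree `d` of a free module with generator in degree `c`
is zero or homogeneous of the complementary degree. -/
lemma mem_ringDeg_iff {c d : ℕ} {p : SRing K n} :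
    p ∈ ringDeg K n c d ↔ p = 0 ∨ ∃ m, p.IsHomogeneous m ∧ c + m = d := by
  constructor
  · intro h
    by_cases hp : p = 0
    · exact Or.inl hp
    · obtain ⟨α, hα⟩ := ne_zero_iff.1 hp
      refine Or.inr ⟨α.degree, isHomogeneous_iff_mem_ringDeg.2 fun β hβ => ?_, h α hα⟩
      have := h α hα
      have := h β hβ
      omega
  · rintro (rfl | ⟨m, hm, rfl⟩)
    · exact zero_mem _
    · intro α hα
      have := isHomogeneous_iff_mem_ringDeg.1 hm α hα
      omega

lemma map_mem_of_mem_freeDeg {V : Type} [AddCommGroup V] [Module (SRing K n) V]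
    {H : ℕ → AddSubgroup V} (hH : IsGrading K n H) {ι : Type} [Fintype ι] {dg : ι → ℕ}
    (φ : (ι →₀ SRing K n) →ₗ[SRing K n] V)
    (hφ : ∀ k, φ (Finsupp.single k 1) ∈ H (dg k)) {d : ℕ} {x : ι →₀ SRing K n}
    (hx : x ∈ freeDeg dg d) : φ x ∈ H d := by
  have : φ x = ∑ k, x k • φ (Finsupp.single k 1) := by
    conv_lhs => rw [← Finsupp.univ_sum_single x]
    rw [map_sum]
    refine Finset.sum_congr rfl fun k _ => ?_
    rw [← map_smul, Finsupp.smul_single, smul_eq_mul, mul_one]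
  rw [this]
  refine sum_mem fun k _ => ?_
  rcases mem_ringDeg_iff.1 (hx k) with h | ⟨m, hm, rfl⟩
  · rw [h, zero_smul]; exact zero_mem _
  · rw [add_comm]
    exact hH _ _ _ _ (isHomogeneous_iff_mem_ringDeg.1 hm) (hφ k)

lemma exists_component {ι : Type} [Fintype ι] (dg : ι → ℕ) (x : ι →₀ SRing K n) (d : ℕ) :
    ∃ y ∈ freeDeg dg d, ∀ (c : ℕ) (φ : (ι →₀ SRing K n) →ₗ[SRing K n] SRing K n),
      (∀ k, φ (Finsupp.single k 1) ∈ ringDeg K n c (dg k)) → φ x ∈ ringDeg K n c d →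
      φ y = φ x := by
  classical
  have h : ∀ k, ∃ g : SRing K n, ∀ α, coeff α g =
      if dg k + α.degree = d then coeff α (x k) else 0 := fun k => exists_coeff_ite _ _
  choose g hg using h
  refine ⟨Finsupp.equivFunOnFinite.symm g, fun k α hα => ?_, fun c φ hφ hx => ?_⟩
  · by_contra hne
    apply hα
    change coeff α (g k) = 0
    rw [hg, if_neg hne]
  · have hsum : ∀ z, φ z = ∑ k, z k * φ (Finsupp.single k 1) := fun z => by
      conv_lhs => rw [← Finsupp.univ_sum_single z]
      rw [map_sum]
      refine Finset.sum_congr rfl fun k _ => ?_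
      rw [← smul_eq_mul (z k), ← map_smul, Finsupp.smul_single, smul_eq_mul, mul_one]
    have key : ∀ β, coeff β (φ (Finsupp.equivFunOnFinite.symm g)) =
        if c + β.degree = d then coeff β (φ x) else 0 := by
      intro β
      have hite : ∀ {σ : Type} (A : Finset σ) (F : σ → K),
          (if c + β.degree = d then ∑ a ∈ A, F a else 0) =
            ∑ a ∈ A, if c + β.degree = d then F a else 0 := fun A F => by
        split_ifs <;> simp
      rw [hsum, hsum x, coeff_sum, coeff_sum, hite]
      refine Finset.sum_congr rfl fun k _ => ?_
      change coeff β (g k * _) = _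
      rw [coeff_mul, coeff_mul, hite]
      refine Finset.sum_congr rfl fun p hp => ?_
      rw [Finset.HasAntidiagonal.mem_antidiagonal] at hp
      by_cases hb : coeff p.2 (φ (Finsupp.single k 1)) = 0
      · simp [hb]
      · have h1 := hφ k _ hb
        have h2 : dg k + p.1.degree = d ↔ c + β.degree = d := by
          rw [← hp, map_add]; omega
        rw [hg, if_congr h2 rfl rfl, ite_mul, zero_mul]
    ext β
    rw [key]
    split_ifs with h
    · rfl
    · by_contra hne
      exact h (hx β fun h' => hne h'.symm)

lemma exists_homogeneous_lift_ring {ι : Type} [Fintype ι] {dg : ι → ℕ} {c d : ℕ}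
    (φ : (ι →₀ SRing K n) →ₗ[SRing K n] SRing K n)
    (hφ : ∀ k, φ (Finsupp.single k 1) ∈ ringDeg K n c (dg k)) {p : SRing K n}
    (hp : p ∈ LinearMap.range φ) (hd : p ∈ ringDeg K n c d) : ∃ y ∈ freeDeg dg d, φ y = p := by
  obtain ⟨x, rfl⟩ := hp
  obtain ⟨y, hy, h⟩ := exists_component dg x d
  exact ⟨y, hy, h c φ hφ hd⟩

lemma exists_homogeneous_lift_free {ι ι' : Type} [Fintype ι] {dg : ι → ℕ} {dg' : ι' → ℕ} {d : ℕ}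
    (φ : (ι →₀ SRing K n) →ₗ[SRing K n] (ι' →₀ SRing K n))
    (hφ : ∀ k, φ (Finsupp.single k 1) ∈ freeDeg dg' (dg k)) {p : ι' →₀ SRing K n}
    (hp : p ∈ LinearMap.range φ) (hd : p ∈ freeDeg dg' d) : ∃ y ∈ freeDeg dg d, φ y = p := by
  obtain ⟨x, rfl⟩ := hp
  obtain ⟨y, hy, h⟩ := exists_component dg x d
  refine ⟨y, hy, ?_⟩
  ext1 l
  exact h (dg' l) (Finsupp.lapply l ∘ₗ φ) (fun k => hφ k l) (hd l)

lemma koszulD_mem_of_mem {V : Type} [AddCommGroup V] [Module (SRing K n) V]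
    {H : ℕ → AddSubgroup V} (hH : IsGrading K n H) {d : ℕ} {w : Finset (Fin n) → V}
    (hw : ∀ T, w T ∈ H d) (T : Finset (Fin n)) : koszulD (K := K) w T ∈ H (d + 1) := by
  refine sum_mem fun v _ => AddSubgroup.zsmul_mem _ ?_ _
  rw [add_comm]
  exact hH _ _ _ _ (X_mem_ringDeg v) (hw _)

lemma GradedPartialRes.diff_mem {I : Ideal (SRing K n)} {r : ℕ∞} (R : GradedPartialRes I r)
    (i : ℕ) (k : Fin (R.s (i + 1))) :
    R.diff i (Finsupp.single k 1) ∈ freeDeg (R.dg i) (R.dg (i + 1) k) :=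
  fun l => mem_ringDeg_iff.2 (R.diff_hom i k l)

/-- Koszul cycles with values in a partial resolution are, up to Koszul boundaries, in the image
of the next differential, provided there are no generators in the critical degree. -/
lemma koszul_descent {I : Ideal (SRing K n)} {r : ℕ∞} (R : GradedPartialRes I r) {i e : ℕ}
    (hr : (i : ℕ∞) < r) (hnone : ∀ k, R.dg i k ≠ e + i) (p : ℕ) :
    ∀ q, q + p = i → ∀ w : Finset (Fin n) → (Fin (R.s q) →₀ SRing K n),
      (∀ T, T.card ≠ p → w T = 0) → (∀ T, w T ∈ freeDeg (R.dg q) (e + q)) →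
      (∀ T, koszulD (K := K) w T ∈ LinearMap.range (R.diff q)) →
      ∃ η : Finset (Fin n) → (Fin (R.s q) →₀ SRing K n), η ∅ = 0 ∧
        ∀ T, w T - koszulD (K := K) η T ∈ LinearMap.range (R.diff q) := by
  induction p with
  | zero =>
    rintro q rfl w hcard hdeg -
    obtain ⟨η, hη0, hη⟩ := koszul_exact (K := K) w
      (fun T => Finset.sum_eq_zero fun v _ => by rw [hcard _ (by simp), smul_zero, smul_zero])
      (fun l => by
        by_contra hne
        exact hnone l (by simpa using hdeg ∅ l 0 hne))
    exact ⟨η, hη0, fun T => by rw [hη, sub_self]; exact zero_mem _⟩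
  | succ p ih =>
    rintro q hq w hcard hdeg hrange
    have hlift : ∀ T, ∃ y ∈ freeDeg (R.dg (q + 1)) (e + q + 1),
        R.diff q y = koszulD (K := K) w T ∧ (T.card ≠ p → y = 0) := by
      intro T
      by_cases hT : T.card = p
      · obtain ⟨y, hy, h⟩ := exists_homogeneous_lift_free (R.diff q) (R.diff_mem q) (hrange T)
          (koszulD_mem_of_mem (isGrading_freeDeg _) hdeg T)
        exact ⟨y, hy, h, fun h => absurd hT h⟩
      · refine ⟨0, zero_mem _, ?_, fun _ => rfl⟩
        rw [map_zero, eq_comm]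
        refine Finset.sum_eq_zero fun v hv => ?_
        rw [hcard _, smul_zero, smul_zero]
        rw [Finset.card_insert_of_notMem (Finset.mem_compl.1 hv)]
        omega
    choose w' hw'deg hw' hw'card using hlift
    have hq1 : ((q : ℕ) : ℕ∞) + 1 < r := by
      refine lt_of_le_of_lt ?_ hr
      rw [← hq]
      push_cast
      gcongr
      exact le_add_self
    obtain ⟨η', hη'0, hη'⟩ := ih (q + 1) (by omega) w' hw'card hw'deg (fun T => by
      rw [R.exact_succ q hq1, LinearMap.mem_ker, ← koszulD_map]
      simp only [hw']
      exact koszulD_koszulD w T)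
    have hdiff : ∀ T, koszulD (K := K) w T = koszulD (K := K) (fun T => R.diff q (η' T)) T := by
      intro T
      have := hη' T
      rw [R.exact_succ q hq1, LinearMap.mem_ker, map_sub, sub_eq_zero, hw'] at this
      rw [this, koszulD_map]
    obtain ⟨η, hη0, hη⟩ := koszul_exact (K := K) (fun T => w T - R.diff q (η' T))
      (fun T => by rw [koszulD_sub, hdiff, sub_self])
      (fun l => by rw [hcard ∅ (by simp), hη'0]; simp)
    exact ⟨η, hη0, fun T => ⟨η' T, by rw [← hη]; abel⟩⟩

/-- A Koszul cochain of degree `e - 1` supported in size `i + 1` whose boundary lies in `I` is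
cohomologous to a cochain with values in `I`, provided `I` has a partial resolution with no
generator of degree `e + i` in position `i`. -/
lemma exists_koszul_boundary {I : Ideal (SRing K n)} {r : ℕ∞} (R : GradedPartialRes I r) {i e : ℕ}
    (hr : (i : ℕ∞) < r) (hnone : ∀ k, R.dg i k ≠ e + i) (y : Finset (Fin n) → SRing K n)
    (hcard : ∀ T, T.card ≠ i + 1 → y T = 0)
    (hdeg : ∀ T, koszulD (K := K) y T ∈ ringDeg K n 0 e)
    (hy : ∀ T, koszulD (K := K) y T ∈ I) :
    ∃ η : Finset (Fin n) → SRing K n, ∀ T, y T - koszulD (K := K) η T ∈ I := by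
  have haug : ∀ k, R.aug (Finsupp.single k 1) ∈ ringDeg K n 0 (R.dg 0 k) := fun k =>
    isHomogeneous_iff_mem_ringDeg.1 (R.aug_hom k)
  have hr0 : (0 : ℕ∞) < r := lt_of_le_of_lt zero_le hr
  have hlift : ∀ T, ∃ x ∈ freeDeg (R.dg 0) e,
      R.aug x = koszulD (K := K) y T ∧ (T.card ≠ i → x = 0) := by
    intro T
    by_cases hT : T.card = i
    · obtain ⟨x, hx, h⟩ := exists_homogeneous_lift_ring R.aug haug
        (by rw [R.aug_range]; exact hy T) (hdeg T)
      exact ⟨x, hx, h, fun h => absurd hT h⟩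
    · refine ⟨0, zero_mem _, ?_, fun _ => rfl⟩
      rw [map_zero, eq_comm]
      refine Finset.sum_eq_zero fun v hv => ?_
      rw [hcard _, smul_zero, smul_zero]
      rw [Finset.card_insert_of_notMem (Finset.mem_compl.1 hv)]
      omega
  choose w hwdeg hw hwcard using hlift
  obtain ⟨η', hη'0, hη'⟩ := koszul_descent R hr hnone i 0 (by omega) w hwcard hwdeg (fun T => by
    rw [R.exact_zero hr0, LinearMap.mem_ker, ← koszulD_map]
    simp only [hw]
    exact koszulD_koszulD y T)
  have hdiff : ∀ T, koszulD (K := K) y T = koszulD (K := K) (fun T => R.aug (η' T)) T := by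
    intro T
    have := hη' T
    rw [R.exact_zero hr0, LinearMap.mem_ker, map_sub, sub_eq_zero, hw] at this
    rw [this, koszulD_map]
  obtain ⟨η, -, hη⟩ := koszul_exact_ring (K := K) (fun T => y T - R.aug (η' T))
    (fun T => by rw [koszulD_sub, hdiff, sub_self])
    (by rw [hcard ∅ (by simp), hη'0]; simp)
  refine ⟨η, fun T => ?_⟩
  have : R.aug (η' T) ∈ LinearMap.range R.aug := ⟨_, rfl⟩
  rw [R.aug_range] at this
  rwa [← hη, sub_sub_cancel]

end Grading

section LowerBound

variable {K : Type} [Field K] {n : ℕ}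

lemma single_add_single_le_iff {i j : Fin n} (hij : i ≠ j) {α : Fin n →₀ ℕ} :
    Finsupp.single i 1 + Finsupp.single j 1 ≤ α ↔ α i ≠ 0 ∧ α j ≠ 0 := by
  constructor
  · intro h
    have h1 := h i
    have h2 := h j
    simp only [Finsupp.add_apply, Finsupp.single_eq_same, Finsupp.single_eq_of_ne hij,
      Finsupp.single_eq_of_ne hij.symm] at h1 h2
    omega
  · rintro ⟨h1, h2⟩ v
    by_cases hi : v = i
    · subst hi
      simp only [Finsupp.add_apply, Finsupp.single_eq_same, Finsupp.single_eq_of_ne hij]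
      omega
    · by_cases hj : v = j
      · subst hj
        simp only [Finsupp.add_apply, Finsupp.single_eq_same, Finsupp.single_eq_of_ne hi]
        omega
      · simp [Finsupp.single_eq_of_ne hi, Finsupp.single_eq_of_ne hj]

lemma mem_edgeIdeal_iff {G : SimpleGraph (Fin n)} {f : SRing K n} :
    f ∈ edgeIdeal K G.Adj ↔ ∀ α, coeff α f ≠ 0 → ∃ i j, G.Adj i j ∧ α i ≠ 0 ∧ α j ≠ 0 := by
  have h : edgeIdeal K G.Adj = Ideal.span ((fun s => monomial s (1 : K)) ''
      {α : Fin n →₀ ℕ | ∃ i j, G.Adj i j ∧ α = Finsupp.single i 1 + Finsupp.single j 1}) := by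
    unfold edgeIdeal
    congr 1
    ext p
    simp only [Set.mem_ofPred_eq, Set.mem_image]
    constructor
    · rintro ⟨i, j, hij, rfl⟩
      exact ⟨_, ⟨i, j, hij, rfl⟩, by rw [X, X, monomial_mul, one_mul]⟩
    · rintro ⟨_, ⟨i, j, hij, rfl⟩, rfl⟩
      exact ⟨i, j, hij, by rw [X, X, monomial_mul, one_mul]⟩
  rw [h, mem_ideal_span_monomial_image]
  simp only [mem_support_iff]
  refine forall₂_congr fun α _ => ?_
  constructor
  · rintro ⟨_, ⟨i, j, hij, rfl⟩, hle⟩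
    exact ⟨i, j, hij, (single_add_single_le_iff hij.ne).1 hle⟩
  · rintro ⟨i, j, hij, hle⟩
    exact ⟨_, ⟨i, j, hij, rfl⟩, (single_add_single_le_iff hij.ne).2 hle⟩

/-- The orientation sign of the edge `ab` in the simplicial chains on `W`. -/
def edgeSign (a b : Fin n) (W : Finset (Fin n)) : ℤ :=
  koszulSign a W * koszulSign b W * if a < b then 1 else -1

lemma eq_zero_of_edgeSign_smul (a b : Fin n) (W : Finset (Fin n)) {c : K}
    (h : edgeSign a b W • c = 0) : c = 0 := by
  have hs : edgeSign a b W * edgeSign a b W = 1 := by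
    have h1 := koszulSign_mul_self a W
    have h2 := koszulSign_mul_self b W
    have h3 : ((if a < b then 1 else -1) * (if a < b then 1 else -1) : ℤ) = 1 := by
      split_ifs <;> simp
    unfold edgeSign
    calc _ = (koszulSign a W * koszulSign a W) * (koszulSign b W * koszulSign b W) *
          ((if a < b then 1 else -1) * (if a < b then 1 else -1) : ℤ) := by ring
      _ = 1 := by rw [h1, h2, h3]; rfl
  rw [← one_smul ℤ c, ← hs, mul_smul, h, smul_zero]

lemma edgeSign_smul_coeff_koszulD (η : Finset (Fin n) → SRing K n) {a b : Fin n}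
    {W : Finset (Fin n)} (hab : a ≠ b) (ha : a ∈ W) (hb : b ∈ W) :
    edgeSign a b W • coeff (Finsupp.single a 1 + Finsupp.single b 1)
        (koszulD (K := K) η ((W.erase a).erase b)) =
      koszulSign b W • coeff (Finsupp.single b 1) (η (W.erase b)) -
        koszulSign a W • coeff (Finsupp.single a 1) (η (W.erase a)) := by
  obtain ⟨T, haT, hbT, rfl⟩ : ∃ T : Finset (Fin n), a ∉ T ∧ b ∉ T ∧ W = insert a (insert b T) :=
    ⟨(W.erase a).erase b, by simp, by simp, by
      rw [Finset.insert_erase (by simp [hb, hab.symm]), Finset.insert_erase ha]⟩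
  have e1 : ((insert a (insert b T)).erase a) = insert b T :=
    Finset.erase_insert (by simp [hab, haT])
  have e2 : ((insert a (insert b T)).erase b) = insert a T := by
    rw [Finset.insert_comm]
    exact Finset.erase_insert (by simp [hab.symm, hbT])
  rw [e1, e2, Finset.erase_insert hbT, coeff_koszulD]
  rw [Finset.sum_eq_add (a := a) (b := b) hab]
  · have c1 : (Finsupp.single a 1 + Finsupp.single b 1 : Fin n →₀ ℕ) a ≠ 0 := by simp
    have c2 : (Finsupp.single a 1 + Finsupp.single b 1 : Fin n →₀ ℕ) b ≠ 0 := by simp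
    rw [if_neg c1, if_neg c2, add_tsub_cancel_left, add_tsub_cancel_right, smul_add, smul_smul,
      smul_smul, sub_eq_add_neg, ← neg_smul]
    have s1 : edgeSign a b (insert a (insert b T)) * koszulSign a T =
        koszulSign b (insert a (insert b T)) := by
      have k1 := koszulSign_mul_self a T
      unfold edgeSign
      rw [koszulSign_insert_of_not_lt (lt_irrefl a)]
      rcases lt_or_gt_of_ne hab with h | h
      · rw [koszulSign_insert_of_not_lt h.not_gt, if_pos h]
        linear_combination koszulSign b (insert a (insert b T)) * k1
      · rw [koszulSign_insert_of_lt hbT h, if_neg h.not_gt]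
        linear_combination koszulSign b (insert a (insert b T)) * k1
    have s2 : edgeSign a b (insert a (insert b T)) * koszulSign b T =
        - koszulSign a (insert a (insert b T)) := by
      have k1 := koszulSign_mul_self b T
      unfold edgeSign
      rw [Finset.insert_comm, koszulSign_insert_of_not_lt (lt_irrefl b)]
      rcases lt_or_gt_of_ne hab with h | h
      · rw [koszulSign_insert_of_lt haT h, if_pos h]
        linear_combination -koszulSign a (insert b (insert a T)) * k1
      · rw [koszulSign_insert_of_not_lt h.not_gt, if_neg h.not_gt]
        linear_combination -koszulSign a (insert b (insert a T)) * k1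
    rw [s1, s2]
  · rintro v - ⟨hva, hvb⟩
    rw [if_pos (by simp [Finsupp.single_eq_of_ne hva, Finsupp.single_eq_of_ne hvb]), smul_zero]
  · intro h
    exact absurd (Finset.mem_compl.2 haT) h
  · intro h
    exact absurd (Finset.mem_compl.2 hbT) h

/-- A facet `{q f, q (f + 1)}` of the independence complex of `G` on `W` that lies on a closed walk
`q` of non-edges forces a generator of degree `|W|` in position `|W| - 3` of every resolution. -/
lemma exists_generator_of_facet {G : SimpleGraph (Fin n)} {r : ℕ∞}
    (R : GradedPartialRes (edgeIdeal K G.Adj) r) {m f i : ℕ} {q : ℕ → Fin n} {W : Finset (Fin n)}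
    (hf : f + 1 < m) (hinj : Set.InjOn q (Set.Iio m)) (hclosed : q m = q 0) (hm : 3 ≤ m)
    (hcyc : ∀ j < m, ¬ G.Adj (q j) (q (j + 1))) (hW : ∀ j, j < m → q j ∈ W)
    (hcard : W.card = i + 3) (hr : (i : ℕ∞) < r)
    (hfacet : ∀ w ∈ W, w ≠ q f → w ≠ q (f + 1) → G.Adj w (q f) ∨ G.Adj w (q (f + 1))) :
    ∃ k, R.dg i k = i + 3 := by
  classical
  by_contra! hnone
  have hinj' : ∀ {a b}, a < m → b < m → q a = q b → a = b := fun ha hb h => hinj ha hb h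
  have hW' : ∀ j, j ≤ m → q j ∈ W := fun j hj => by
    rcases hj.lt_or_eq with h | rfl
    · exact hW j h
    · rw [hclosed]; exact hW 0 (by omega)
  have hne : ∀ j < m, q j ≠ q (j + 1) := fun j hj h => by
    rcases Nat.lt_or_ge (j + 1) m with h1 | h1
    · have := hinj' hj h1 h
      omega
    · have h2 : j + 1 = m := by omega
      rw [h2, hclosed] at h
      have := hinj' hj (by omega) h
      omega
  set c := q f with hc
  set c' := q (f + 1) with hc'
  have hcc : c ≠ c' := hne f (by omega)
  set T₀ := (W.erase c).erase c' with hT₀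
  have hT₀card : T₀.card = i + 1 := by
    rw [hT₀, Finset.card_erase_of_mem, Finset.card_erase_of_mem, hcard]
    · rfl
    · exact hW' _ (by omega)
    · exact Finset.mem_erase.2 ⟨hcc.symm, hW' _ (by omega)⟩
  let y : Finset (Fin n) → SRing K n := fun T => if T = T₀ then X c * X c' else 0
  have hdy : ∀ T, koszulD (K := K) y T = 0 ∨
      ∃ v ∈ T₀, koszulD (K := K) y T = koszulSign v T • (X v * (X c * X c')) := by
    intro T
    by_cases h : ∃ v ∈ Tᶜ, insert v T = T₀
    · obtain ⟨v, hv, hvT⟩ := h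
      refine Or.inr ⟨v, hvT ▸ Finset.mem_insert_self v T, ?_⟩
      unfold koszulD
      rw [Finset.sum_eq_single_of_mem v hv]
      · simp only [y, if_pos hvT, smul_eq_mul]
      · intro u hu huv
        have : insert u T ≠ T₀ := fun h => by
          have : v ∈ insert u T := by rw [h, ← hvT]; exact Finset.mem_insert_self v T
          rcases Finset.mem_insert.1 this with h | h
          · exact huv h.symm
          · exact Finset.mem_compl.1 hv h
        simp only [y, if_neg this, smul_zero]
    · push Not at h
      refine Or.inl (Finset.sum_eq_zero fun v hv => ?_)
      simp only [y, if_neg (h v hv), smul_zero]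
  have hX : ∀ v : Fin n, (X v * (X c * X c') : SRing K n) =
      monomial (Finsupp.single v 1 + (Finsupp.single c 1 + Finsupp.single c' 1)) 1 := fun v => by
    rw [X, X, X, monomial_mul, monomial_mul, one_mul, one_mul]
  obtain ⟨η, hη⟩ := exists_koszul_boundary (e := 3) R hr
    (fun k => by rw [add_comm]; exact hnone k) y
    (fun T hT => if_neg fun h : T = T₀ => hT (by rw [h]; exact hT₀card))
    (fun T => by
      rcases hdy T with h | ⟨v, -, h⟩
      · rw [h]; exact zero_mem _
      · rw [h]
        refine AddSubgroup.zsmul_mem _ ?_ _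
        exact ringDeg_mul (X_mem_ringDeg v)
          (ringDeg_mul (X_mem_ringDeg c) (X_mem_ringDeg c')))
    (fun T => by
      rcases hdy T with h | ⟨v, hv, h⟩
      · rw [h]; exact zero_mem _
      · rw [h]
        refine zsmul_mem ?_ _
        rw [hX, mem_edgeIdeal_iff]
        intro α hα
        rw [coeff_monomial] at hα
        obtain rfl : _ = α := by
          by_contra hne
          exact hα (if_neg hne)
        have hv' := Finset.mem_erase.1 hv
        have hv'' := Finset.mem_erase.1 hv'.2
        rcases hfacet v hv''.2 hv''.1 hv'.1 with h | h
        · exact ⟨v, c, h, by simp, by simp⟩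
        · exact ⟨v, c', h, by simp, by simp⟩)
  have hterm : ∀ j < m, edgeSign (q j) (q (j + 1)) W • coeff
      (Finsupp.single (q j) 1 + Finsupp.single (q (j + 1)) 1)
        (y ((W.erase (q j)).erase (q (j + 1)))) =
      koszulSign (q (j + 1)) W • coeff (Finsupp.single (q (j + 1)) 1) (η (W.erase (q (j + 1)))) -
        koszulSign (q j) W • coeff (Finsupp.single (q j) 1) (η (W.erase (q j))) := by
    intro j hj
    rw [← edgeSign_smul_coeff_koszulD η (hne j hj) (hW' j hj.le) (hW' (j + 1) hj)]
    congr 1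
    rw [← sub_eq_zero, ← coeff_sub]
    by_contra hcoeff
    obtain ⟨a, b, hab, ha, hb⟩ := mem_edgeIdeal_iff.1 (hη _) _ hcoeff
    have hmem : ∀ v, (Finsupp.single (q j) 1 + Finsupp.single (q (j + 1)) 1 : Fin n →₀ ℕ) v ≠ 0 →
        v = q j ∨ v = q (j + 1) := by
      intro v hv
      by_contra! h
      exact hv (by simp [Finsupp.single_eq_of_ne h.1, Finsupp.single_eq_of_ne h.2])
    rcases hmem a ha with rfl | rfl <;> rcases hmem b hb with rfl | rfl
    · exact hab.ne rfl
    · exact hcyc j hj hab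
    · exact hcyc j hj hab.symm
    · exact hab.ne rfl
  have hsum : ∑ j ∈ Finset.range m, edgeSign (q j) (q (j + 1)) W • coeff
      (Finsupp.single (q j) 1 + Finsupp.single (q (j + 1)) 1)
        (y ((W.erase (q j)).erase (q (j + 1)))) = 0 := by
    rw [Finset.sum_congr rfl fun j hj => hterm j (Finset.mem_range.1 hj),
      Finset.sum_range_sub fun j =>
        koszulSign (q j) W • coeff (Finsupp.single (q j) 1) (η (W.erase (q j))), hclosed, sub_self]
  rw [Finset.sum_eq_single_of_mem f (Finset.mem_range.2 (by omega))] at hsum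
  · have := eq_zero_of_edgeSign_smul _ _ _ hsum
    simp only [y] at this
    rw [if_pos rfl, X, X, monomial_mul, coeff_monomial, if_pos rfl] at this
    simp at this
  · intro j hj hjf
    have hj' := Finset.mem_range.1 hj
    have : (W.erase (q j)).erase (q (j + 1)) ≠ T₀ := by
      intro h
      have h1 : ∀ v ∈ W, (v = q j ∨ v = q (j + 1)) → v = c ∨ v = c' := by
        intro v hv hvj
        by_contra! hcon
        have : v ∈ T₀ := Finset.mem_erase.2 ⟨hcon.2, Finset.mem_erase.2 ⟨hcon.1, hv⟩⟩
        rw [← h] at this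
        have h1 := Finset.mem_erase.1 this
        have h2 := Finset.mem_erase.1 h1.2
        exact hvj.elim h2.1 h1.1
      have h2 := h1 _ (hW' j hj'.le) (Or.inl rfl)
      have h3 := h1 _ (hW' (j + 1) hj') (Or.inr rfl)
      have h4 : j = f + 1 := by
        rcases h2 with h2 | h2
        · exact absurd (hinj' hj' (by omega) h2) hjf
        · exact hinj' hj' hf h2
      have h5 : q (j + 1) = c := by
        rcases h3 with h3 | h3
        · exact h3
        · rw [hc', ← h4] at h3
          exact absurd h3.symm (hne j hj')
      rcases Nat.lt_or_ge (j + 1) m with h6 | h6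
      · have := hinj' h6 (by omega) h5
        omega
      · have h7 : j + 1 = m := by omega
        rw [h7, hclosed] at h5
        have := hinj' (by omega) (by omega) h5
        omega
    simp only [y, if_neg this, coeff_zero, smul_zero]

end LowerBound

section Anticycle

variable {K : Type} [Field K] {n : ℕ}

/-- `q 0, …, q (m - 1)` is an induced cycle of length `m ≥ 4` in the complement of `G`. -/
structure IsAnticycle (G : SimpleGraph (Fin n)) (m : ℕ) (q : ℕ → Fin n) : Prop where
  four_le : 4 ≤ m
  closed : q m = q 0
  inj : Set.InjOn q (Set.Iio m)
  not_adj_iff : ∀ i j, i < j → j < m → (¬ G.Adj (q i) (q j) ↔ j = i + 1 ∨ i = 0 ∧ j + 1 = m)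

namespace IsAnticycle

variable {G : SimpleGraph (Fin n)} {m : ℕ} {q : ℕ → Fin n}

lemma eq_of_eq (h : IsAnticycle G m q) {i j : ℕ} (hi : i < m) (hj : j < m) (hij : q i = q j) :
    i = j :=
  h.inj hi hj hij

lemma not_adj_succ (h : IsAnticycle G m q) {j : ℕ} (hj : j < m) : ¬ G.Adj (q j) (q (j + 1)) := by
  rcases Nat.lt_or_ge (j + 1) m with h1 | h1
  · exact (h.not_adj_iff j (j + 1) (by omega) h1).2 (Or.inl rfl)
  · have h2 : j + 1 = m := by omega
    have h4 := h.four_le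
    rw [h2, h.closed, G.adj_comm]
    exact (h.not_adj_iff 0 j (by omega) hj).2 (Or.inr ⟨rfl, h2⟩)

lemma adj (h : IsAnticycle G m q) {i j : ℕ} (hij : i + 2 ≤ j) (hj : j < m)
    (h0 : ¬ (i = 0 ∧ j + 1 = m)) : G.Adj (q i) (q j) := by
  by_contra hadj
  rcases (h.not_adj_iff i j (by omega) hj).1 hadj with h1 | h1
  · omega
  · exact h0 h1

lemma adj_facet (h : IsAnticycle G m q) {f j : ℕ} (hf : f + 1 < m) (hj : j < m) (h1 : j ≠ f)
    (h2 : j ≠ f + 1) : G.Adj (q j) (q f) ∨ G.Adj (q j) (q (f + 1)) := by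
  have h4 := h.four_le
  by_contra! hcon
  rcases Nat.lt_or_gt_of_ne h1 with hlt | hgt
  · have e1 := (h.not_adj_iff j f hlt (by omega)).1 hcon.1
    have e2 := (h.not_adj_iff j (f + 1) (by omega) hf).1 hcon.2
    omega
  · have e1 := (h.not_adj_iff f j hgt hj).1 (fun e => hcon.1 e.symm)
    have e2 := (h.not_adj_iff (f + 1) j (by omega) hj).1 (fun e => hcon.2 e.symm)
    omega

lemma card_image (h : IsAnticycle G m q) : ((Finset.range m).image q).card = m := by
  rw [Finset.card_image_of_injOn, Finset.card_range]
  rw [Finset.coe_range]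
  exact h.inj

lemma exists_generator (h : IsAnticycle G m q) {r : ℕ∞}
    (R : GradedPartialRes (edgeIdeal K G.Adj) r) {i : ℕ} (hi : m = i + 3) (hr : (i : ℕ∞) < r) :
    ∃ k, R.dg i k = i + 3 := by
  have h4 := h.four_le
  refine exists_generator_of_facet R (f := 0) (W := (Finset.range m).image q) (by omega) h.inj
    h.closed (by omega) (fun j hj => h.not_adj_succ hj)
    (fun j hj => Finset.mem_image_of_mem q (Finset.mem_range.2 hj)) (h.card_image.trans hi) hr ?_
  intro w hw h0 h1
  obtain ⟨j, hj, rfl⟩ := Finset.mem_image.1 hw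
  exact h.adj_facet (by omega) (Finset.mem_range.1 hj) (fun e => h0 (by rw [e]))
    (fun e => h1 (by rw [e]))

lemma exists_generator_of_adj (h : IsAnticycle G m q) {r : ℕ∞}
    (R : GradedPartialRes (edgeIdeal K G.Adj) r) {i j : ℕ} {v : Fin n} (hi : m = i + 2)
    (hr : (i : ℕ∞) < r) (hv : ∀ l < m, v ≠ q l) (hj : j < m) (hadj : G.Adj v (q j)) :
    ∃ k, R.dg i k = i + 3 := by
  have h4 := h.four_le
  obtain ⟨f, hf, hjf⟩ : ∃ f, f + 1 < m ∧ (j = f ∨ j = f + 1) := by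
    rcases Nat.lt_or_ge (j + 1) m with h1 | h1
    · exact ⟨j, h1, Or.inl rfl⟩
    · exact ⟨j - 1, by omega, Or.inr (by omega)⟩
  refine exists_generator_of_facet R (f := f) (W := insert v ((Finset.range m).image q)) hf h.inj
    h.closed (by omega) (fun j hj => h.not_adj_succ hj)
    (fun j hj => Finset.mem_insert_of_mem
      (Finset.mem_image_of_mem q (Finset.mem_range.2 hj))) ?_ hr ?_
  · rw [Finset.card_insert_of_notMem, h.card_image, hi]
    intro hmem
    obtain ⟨l, hl, e⟩ := Finset.mem_image.1 hmem
    exact hv l (Finset.mem_range.1 hl) e.symm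
  · intro w hw h0 h1
    rcases Finset.mem_insert.1 hw with rfl | hw
    · rcases hjf with rfl | rfl
      · exact Or.inl hadj
      · exact Or.inr hadj
    · obtain ⟨l, hl, rfl⟩ := Finset.mem_image.1 hw
      exact h.adj_facet hf (Finset.mem_range.1 hl) (fun e => h0 (by rw [e]))
        (fun e => h1 (by rw [e]))

end IsAnticycle

lemma one_le_gradedBetti {I : Ideal (SRing K n)} {i j : ℕ}
    (h : ∀ R : GradedPartialRes I ((i : ℕ∞) + 1), ∃ k, R.dg i k = j) : 1 ≤ gradedBetti I i j := by
  refine le_iInf fun R => ?_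
  obtain ⟨k, hk⟩ := h R
  have : 0 < (Finset.univ.filter fun k => R.dg i k = j).card :=
    Finset.card_pos.2 ⟨k, Finset.mem_filter.2 ⟨Finset.mem_univ _, hk⟩⟩
  exact_mod_cast this

lemma natCast_lt_add_one (i : ℕ) : (i : ℕ∞) < (i : ℕ∞) + 1 := by
  exact_mod_cast Nat.lt_succ_self i

lemma IsAnticycle.one_le_gradedBetti {G : SimpleGraph (Fin n)} {m : ℕ} {q : ℕ → Fin n}
    (h : IsAnticycle G m q) {i : ℕ} (hi : m = i + 3) :
    1 ≤ gradedBetti (edgeIdeal K G.Adj) i (i + 3) :=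
  _root_.one_le_gradedBetti fun R => h.exists_generator R hi (natCast_lt_add_one i)

lemma exists_resolution_of_projDim_eq {I : Ideal (SRing K n)} {t : ℕ}
    (h : projDim I = (t : ℕ∞)) : ∃ R : GradedPartialRes I ⊤, ∀ i, t < i → R.s i = 0 := by
  have hne : {x : ℕ∞ | ∃ m : ℕ, x = (m : ℕ∞) ∧
      ∃ R : GradedPartialRes I ⊤, ∀ i : ℕ, m < i → R.s i = 0}.Nonempty := by
    by_contra hcon
    rw [Set.not_nonempty_iff_eq_empty] at hcon
    unfold projDim at h
    rw [hcon, sInf_empty] at h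
    exact ENat.top_ne_natCast t h
  obtain ⟨m, hm, R, hR⟩ := csInf_mem hne
  have : m = t := by
    have h' : (m : ℕ∞) = t := hm.symm.trans h
    exact_mod_cast h'
  exact ⟨R, this ▸ hR⟩

lemma stepsLinear_of_lt_idealIndex {I : Ideal (SRing K n)} {d s : ℕ}
    (h : (s : ℕ∞) < idealIndex I d) : ∃ r, s ≤ r ∧ stepsLinear I d r := by
  obtain ⟨_, ⟨r, rfl, hr⟩, hlt⟩ := lt_sSup_iff.1 h
  exact ⟨r, by exact_mod_cast Order.lt_add_one_iff.1 (by exact_mod_cast hlt : s < r + 1), hr⟩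

lemma IsAnticycle.eq_add_three {G : SimpleGraph (Fin n)} {m t : ℕ} {q : ℕ → Fin n}
    (h : IsAnticycle G m q) (hind : idealIndex (edgeIdeal K G.Adj) 2 = (t : ℕ∞))
    (R : GradedPartialRes (edgeIdeal K G.Adj) ⊤) (hR : ∀ i, t < i → R.s i = 0) : m = t + 3 := by
  have h4 := h.four_le
  obtain ⟨s, rfl⟩ : ∃ s, m = s + 3 := ⟨m - 3, by omega⟩
  have h1 : s ≤ t := by
    by_contra! hlt
    obtain ⟨k, -⟩ := h.exists_generator R rfl (ENat.natCast_lt_top s)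
    exact (Fin.cast (hR s hlt) k).elim0
  have h2 : t ≤ s := by
    by_contra! hlt
    obtain ⟨r, hr, hlin⟩ := stepsLinear_of_lt_idealIndex (s := s)
      (I := edgeIdeal K G.Adj) (d := 2) (by rw [hind]; exact_mod_cast hlt)
    have := h.one_le_gradedBetti (K := K) rfl
    rw [hlin s hr 3 (by omega)] at this
    simp at this
  omega

lemma mem_span_monomial_pair {γ₁ γ₂ : Fin n →₀ ℕ} {f : SRing K n}
    (h : ∀ α, coeff α f ≠ 0 → γ₁ ≤ α ∨ γ₂ ≤ α) :
    ∃ p q, f = monomial γ₁ 1 * p + monomial γ₂ 1 * q := by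
  have : f ∈ Ideal.span ((fun s => monomial s (1 : K)) '' {γ₁, γ₂}) := by
    rw [mem_ideal_span_monomial_image]
    intro α hα
    rcases h α (mem_support_iff.1 hα) with h | h
    · exact ⟨γ₁, by simp, h⟩
    · exact ⟨γ₂, by simp, h⟩
  rw [Set.image_pair] at this
  obtain ⟨p, q, h⟩ := Ideal.mem_span_pair.1 this
  exact ⟨p, q, by rw [← h]; ring⟩

lemma le_of_coeff_monomial_mul {γ α : Fin n →₀ ℕ} {f : SRing K n}
    (h : coeff α (monomial γ 1 * f) ≠ 0) : γ ≤ α := by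
  classical
  rw [coeff_monomial_mul'] at h
  by_contra hle
  exact h (if_neg hle)

lemma le_of_le_add {γ δ α : Fin n →₀ ℕ} (hd : ∀ v, γ v = 0 ∨ δ v = 0) (h : γ ≤ δ + α) : γ ≤ α := by
  intro v
  have := h v
  rw [Finsupp.add_apply] at this
  rcases hd v with h0 | h0 <;> omega

lemma exists_eq_of_monomial_smul_eq_sub {s : ℕ} {γ₁ γ₂ γ₃ : Fin n →₀ ℕ}
    (h₁ : ∀ v, γ₁ v = 0 ∨ γ₃ v = 0) (h₂ : ∀ v, γ₂ v = 0 ∨ γ₃ v = 0)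
    {a b c : Fin s →₀ SRing K n}
    (h : (monomial γ₃ 1 : SRing K n) • a =
      (monomial γ₂ 1 : SRing K n) • b - (monomial γ₁ 1 : SRing K n) • c) :
    ∃ p q : Fin s →₀ SRing K n,
      a = (monomial γ₁ 1 : SRing K n) • p + (monomial γ₂ 1 : SRing K n) • q := by
  have hl : ∀ l, ∃ p q, a l = monomial γ₁ 1 * p + monomial γ₂ 1 * q := by
    intro l
    refine mem_span_monomial_pair fun α hα => ?_
    have hl := congrArg (fun z => coeff (γ₃ + α) (z l)) h
    simp only [Finsupp.smul_apply, Finsupp.sub_apply, smul_eq_mul, coeff_monomial_mul, one_mul,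
      coeff_sub] at hl
    by_cases hb : coeff (γ₃ + α) (monomial γ₂ 1 * b l) = 0
    · left
      refine le_of_le_add h₁ (le_of_coeff_monomial_mul (f := c l) fun hc => hα ?_)
      rw [hl, hb, hc, sub_zero]
    · exact Or.inr (le_of_le_add h₂ (le_of_coeff_monomial_mul hb))
  choose p q hpq using hl
  refine ⟨Finsupp.equivFunOnFinite.symm p, Finsupp.equivFunOnFinite.symm q, ?_⟩
  ext1 l
  exact hpq l

lemma exists_eq_of_monomial_smul_eq {s : ℕ} {γ₁ γ₂ : Fin n →₀ ℕ}
    (h₁ : ∀ v, γ₁ v = 0 ∨ γ₂ v = 0) {a b : Fin s →₀ SRing K n}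
    (h : (monomial γ₂ 1 : SRing K n) • a = (monomial γ₁ 1 : SRing K n) • b) :
    ∃ g : Fin s →₀ SRing K n, a = (monomial γ₁ 1 : SRing K n) • g := by
  obtain ⟨p, q, hpq⟩ := exists_eq_of_monomial_smul_eq_sub (γ₁ := γ₁) (γ₂ := γ₁) h₁ h₁
    (a := a) (b := b) (c := 0) (by rw [h, smul_zero, sub_zero])
  exact ⟨p + q, by rw [hpq, smul_add]⟩

/-- Three pairwise disjoint edges force projective dimension at least two. -/
lemma s_two_ne_zero {G : SimpleGraph (Fin n)} (R : GradedPartialRes (edgeIdeal K G.Adj) ⊤)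
    {γ₁ γ₂ γ₃ : Fin n →₀ ℕ} (h12 : ∀ v, γ₁ v = 0 ∨ γ₂ v = 0) (h13 : ∀ v, γ₁ v = 0 ∨ γ₃ v = 0)
    (h23 : ∀ v, γ₂ v = 0 ∨ γ₃ v = 0)
    (h1 : (monomial γ₁ 1 : SRing K n) ∈ edgeIdeal K G.Adj)
    (h2 : (monomial γ₂ 1 : SRing K n) ∈ edgeIdeal K G.Adj)
    (h3 : (monomial γ₃ 1 : SRing K n) ∈ edgeIdeal K G.Adj) : R.s 2 ≠ 0 := by
  intro hs
  have hinj : ∀ z, R.diff 0 z = 0 → z = 0 := by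
    intro z hz
    have : z ∈ LinearMap.range (R.diff 1) := by
      rw [R.exact_succ 0 (by simp)]
      exact hz
    obtain ⟨y, rfl⟩ := this
    have : y = 0 := by
      ext1 l
      exact (Fin.cast hs l).elim0
    rw [this, map_zero]
  have hlift : ∀ z, z ∈ edgeIdeal K G.Adj → ∃ e, R.aug e = z := by
    intro z hz
    rw [← R.aug_range] at hz
    exact hz
  have hker : ∀ z, R.aug z = 0 → ∃ y, R.diff 0 y = z := by
    intro z hz
    have : z ∈ LinearMap.range (R.diff 0) := by
      rw [R.exact_zero (by simp)]
      exact hz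
    exact this
  obtain ⟨e₁, he₁⟩ := hlift _ h1
  obtain ⟨e₂, he₂⟩ := hlift _ h2
  obtain ⟨e₃, he₃⟩ := hlift _ h3
  set m₁ : SRing K n := monomial γ₁ 1 with hm₁
  set m₂ : SRing K n := monomial γ₂ 1 with hm₂
  set m₃ : SRing K n := monomial γ₃ 1 with hm₃
  obtain ⟨s₁₂, hs₁₂⟩ := hker (m₂ • e₁ - m₁ • e₂) (by
    rw [map_sub, map_smul, map_smul, he₁, he₂, smul_eq_mul, smul_eq_mul]; ring)
  obtain ⟨s₁₃, hs₁₃⟩ := hker (m₃ • e₁ - m₁ • e₃) (by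
    rw [map_sub, map_smul, map_smul, he₁, he₃, smul_eq_mul, smul_eq_mul]; ring)
  obtain ⟨s₂₃, hs₂₃⟩ := hker (m₃ • e₂ - m₂ • e₃) (by
    rw [map_sub, map_smul, map_smul, he₂, he₃, smul_eq_mul, smul_eq_mul]; ring)
  have hrel : m₃ • s₁₂ = m₂ • s₁₃ - m₁ • s₂₃ := by
    rw [← sub_eq_zero]
    apply hinj
    simp only [map_sub, map_smul, hs₁₂, hs₁₃, hs₂₃]
    module
  obtain ⟨p, q, hpq⟩ := exists_eq_of_monomial_smul_eq_sub h13 h23 hrel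
  obtain ⟨g, hg⟩ := exists_eq_of_monomial_smul_eq (γ₁ := γ₁) (γ₂ := γ₂) h12
    (a := e₁ - R.diff 0 q) (b := e₂ + R.diff 0 p) (by
      rw [hpq, map_add, map_smul, map_smul] at hs₁₂
      rw [smul_sub, smul_add, sub_eq_iff_eq_add, ← hm₁, ← hm₂]
      rw [eq_sub_iff_add_eq] at hs₁₂
      rw [← hs₁₂]
      abel)
  have h0 : R.aug (R.diff 0 q) = 0 := by
    have : R.diff 0 q ∈ LinearMap.range (R.diff 0) := ⟨q, rfl⟩
    rw [R.exact_zero (by simp)] at this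
    exact this
  have hone : (1 : SRing K n) = R.aug g := by
    have := congrArg R.aug hg
    rw [map_sub, he₁, h0, sub_zero, map_smul, smul_eq_mul, ← hm₁] at this
    have hne : m₁ ≠ 0 := by
      rw [hm₁, Ne, monomial_eq_zero]
      exact one_ne_zero
    exact mul_left_cancel₀ hne (by rw [mul_one]; exact this)
  have hmem : (1 : SRing K n) ∈ edgeIdeal K G.Adj := by
    have : R.aug g ∈ LinearMap.range R.aug := ⟨g, rfl⟩
    rwa [R.aug_range, ← hone] at this
  obtain ⟨_, _, -, h, -⟩ := mem_edgeIdeal_iff.1 hmem 0 (by simp)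
  exact h rfl

lemma monomial_mem_edgeIdeal {G : SimpleGraph (Fin n)} {a b : Fin n} (h : G.Adj a b) :
    (monomial (Finsupp.single a 1 + Finsupp.single b 1) 1 : SRing K n) ∈ edgeIdeal K G.Adj :=
  Ideal.subset_span ⟨a, b, h, by rw [X, X, monomial_mul, one_mul]⟩

lemma single_add_single_disjoint {a b c d : Fin n} (h1 : a ≠ c) (h2 : a ≠ d) (h3 : b ≠ c)
    (h4 : b ≠ d) (v : Fin n) : (Finsupp.single a 1 + Finsupp.single b 1 : Fin n →₀ ℕ) v = 0 ∨
      (Finsupp.single c 1 + Finsupp.single d 1 : Fin n →₀ ℕ) v = 0 := by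
  classical
  simp only [Finsupp.add_apply, Finsupp.single_apply]
  grind

lemma isAnticycle_four {G : SimpleGraph (Fin n)} {a b c d : Fin n} (hab : ¬ G.Adj a b)
    (hbc : ¬ G.Adj b c) (hcd : ¬ G.Adj c d) (hda : ¬ G.Adj d a) (hac : G.Adj a c)
    (hbd : G.Adj b d) (ab : a ≠ b) (bc : b ≠ c) (cd : c ≠ d) (da : d ≠ a) :
    IsAnticycle G 4 (fun j => if j = 1 then b else if j = 2 then c else
      if j = 3 then d else a) := by
  have ac := hac.ne
  have bd := hbd.ne
  have had : ¬ G.Adj a d := fun e => hda e.symm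
  refine ⟨le_rfl, by simp, ?_, ?_⟩
  · intro i hi j hj hij
    simp only [Set.mem_Iio] at hi hj
    interval_cases i <;> interval_cases j <;> simp only [] at hij ⊢ <;>
      first | rfl | (exfalso; revert hij; simp [ab, bc, cd, da, ac, bd, ab.symm, bc.symm,
        cd.symm, da.symm, ac.symm, bd.symm])
  · intro i j hij hj
    interval_cases j <;> interval_cases i <;>
      simp [hab, hbc, hcd, had, hac, hbd]

lemma IsAnticycle.card_eq {G : SimpleGraph (Fin n)} {m t : ℕ} {q : ℕ → Fin n}
    (h : IsAnticycle G m q) (hiso : ∀ a : Fin n, ∃ b, G.Adj a b)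
    (hind : idealIndex (edgeIdeal K G.Adj) 2 = (t : ℕ∞))
    (R : GradedPartialRes (edgeIdeal K G.Adj) ⊤) (hR : ∀ i, t < i → R.s i = 0) : n = m := by
  have h4 := h.four_le
  have hm := h.eq_add_three hind R hR
  have hout : ∀ v, (∀ l < m, v ≠ q l) → ∀ j < m, ¬ G.Adj v (q j) := by
    intro v hv j hj hadj
    obtain ⟨k, -⟩ := h.exists_generator_of_adj R (i := t + 1) (by omega)
      (by exact_mod_cast ENat.natCast_lt_top (t + 1)) hv hj hadj
    exact (Fin.cast (hR (t + 1) (by omega)) k).elim0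
  have hall : ∀ v, ∃ l < m, v = q l := by
    by_contra! hcon
    obtain ⟨v, hv⟩ := hcon
    obtain ⟨u, hvu⟩ := hiso v
    have hu : ∀ l < m, u ≠ q l := by
      rintro l hl rfl
      exact hout v hv l hl hvu
    have hq02 : G.Adj (q 0) (q 2) := h.adj (by omega) (by omega) (by omega)
    have hq13 : G.Adj (q 1) (q 3) := h.adj (by omega) (by omega) (by omega)
    have hq : ∀ i j, i < m → j < m → i ≠ j → q i ≠ q j :=
      fun i j hi hj hij e => hij (h.eq_of_eq hi hj e)
    have hsq := isAnticycle_four (hout v hv 0 (by omega)) (fun e => hout u hu 0 (by omega) e.symm)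
      (hout u hu 2 (by omega)) (fun e => hout v hv 2 (by omega) e.symm) hvu hq02
      (hv 0 (by omega)) (hu 0 (by omega)).symm (hu 2 (by omega)) (hv 2 (by omega)).symm
    have ht := hsq.eq_add_three hind R hR
    refine s_two_ne_zero R (γ₁ := Finsupp.single v 1 + Finsupp.single u 1)
      (γ₂ := Finsupp.single (q 0) 1 + Finsupp.single (q 2) 1)
      (γ₃ := Finsupp.single (q 1) 1 + Finsupp.single (q 3) 1)
      (single_add_single_disjoint ?_ ?_ ?_ ?_) (single_add_single_disjoint ?_ ?_ ?_ ?_)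
      (single_add_single_disjoint ?_ ?_ ?_ ?_) (monomial_mem_edgeIdeal hvu)
      (monomial_mem_edgeIdeal hq02) (monomial_mem_edgeIdeal hq13) (hR 2 (by omega))
    any_goals first | exact hv _ (by omega) | exact hu _ (by omega) |
      exact hq _ _ (by omega) (by omega) (by omega)
  have himage : (Finset.range m).image q = Finset.univ := by
    rw [Finset.eq_univ_iff_forall]
    intro v
    obtain ⟨l, hl, rfl⟩ := hall v
    exact Finset.mem_image_of_mem q (Finset.mem_range.2 hl)
  have := h.card_image
  rw [himage, Finset.card_univ, Fintype.card_fin] at this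
  exact this

end Anticycle

section UpperBound

variable {K : Type} [Field K] {n : ℕ}

/-- `HasBound r H M b`: the first `r` steps of some graded free resolution of `M` have at most
`b i j` generators of degree `j` in position `i`, the ambient module being graded by `H`. -/
def HasBound (K : Type) [Field K] (n : ℕ) : ∀ (_ : ℕ) {V : Type} [AddCommGroup V]
    [Module (SRing K n) V] (_ : ℕ → AddSubgroup V) (_ : Submodule (SRing K n) V)
    (_ : ℕ → ℕ → ℕ∞), Prop
  | 0, _, _, _, _, _, _ => True
  | r + 1, V, _, _, H, M, b => ∃ (ι : Type) (_ : Fintype ι) (dg : ι → ℕ)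
      (aug : (ι →₀ SRing K n) →ₗ[SRing K n] V),
      (∀ k, aug (Finsupp.single k 1) ∈ H (dg k)) ∧ LinearMap.range aug = M ∧
      (∀ d, ∀ x ∈ M, x ∈ H d → ∃ y ∈ freeDeg dg d, aug y = x) ∧
      (∀ j, ((Finset.univ.filter fun k => dg k = j).card : ℕ∞) ≤ b 0 j) ∧
      HasBound K n r (freeDeg dg) (LinearMap.ker aug) (fun i => b (i + 1))

lemma HasBound.mono {r : ℕ} : ∀ {V : Type} [AddCommGroup V] [Module (SRing K n) V]
    {H : ℕ → AddSubgroup V} {M : Submodule (SRing K n) V} {b b' : ℕ → ℕ → ℕ∞},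
    HasBound K n r H M b → (∀ i j, b i j ≤ b' i j) → HasBound K n r H M b' := by
  induction r with
  | zero => intros; trivial
  | succ r ih =>
    intro V _ _ H M b b' ⟨ι, hι, dg, aug, h1, h2, h3, h4, h5⟩ hb
    exact ⟨ι, hι, dg, aug, h1, h2, h3, fun j => (h4 j).trans (hb 0 j),
      ih h5 fun i j => hb (i + 1) j⟩

lemma HasBound.bot {r : ℕ} : ∀ {V : Type} [AddCommGroup V] [Module (SRing K n) V]
    {H : ℕ → AddSubgroup V} {M : Submodule (SRing K n) V} {b : ℕ → ℕ → ℕ∞},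
    M = ⊥ → HasBound K n r H M b := by
  induction r with
  | zero => intros; trivial
  | succ r ih =>
    rintro V _ _ H _ b rfl
    refine ⟨Empty, inferInstance, Empty.elim, 0, fun k => k.elim, LinearMap.range_zero, ?_, ?_,
      ih ?_⟩
    · rintro d x hx -
      exact ⟨0, zero_mem _, ((Submodule.mem_bot _).1 hx).symm⟩
    · intro j
      simp
    · rw [Submodule.eq_bot_iff]
      intro x _
      exact Subsingleton.elim _ _

lemma mem_freeDeg_add_iff {ι : Type} {dg : ι → ℕ} {d e : ℕ} {y : ι →₀ SRing K n} :
    y ∈ freeDeg (fun k => dg k + e) (d + e) ↔ y ∈ freeDeg dg d := by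
  simp only [mem_freeDeg, mem_ringDeg]
  refine forall_congr' fun l => forall₂_congr fun α _ => ?_
  omega

/-- Transport along an injective map that shifts degrees by `e`. -/
lemma HasBound.map {r : ℕ} : ∀ {V V' : Type} [AddCommGroup V] [Module (SRing K n) V]
    [AddCommGroup V'] [Module (SRing K n) V'] {H : ℕ → AddSubgroup V} {H' : ℕ → AddSubgroup V'}
    {M : Submodule (SRing K n) V} {b b' : ℕ → ℕ → ℕ∞} (φ : V →ₗ[SRing K n] V') (e : ℕ),
    Function.Injective φ → (∀ d x, φ x ∈ H' (d + e) ↔ x ∈ H d) →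
    (∀ d x, d < e → φ x ∈ H' d → x = 0) → (∀ i j, b i j ≤ b' i (j + e)) →
    HasBound K n r H M b → HasBound K n r H' (M.map φ) b' := by
  induction r with
  | zero => intros; trivial
  | succ r ih =>
    intro V V' _ _ _ _ H H' M b b' φ e hinj hdeg hlow hb ⟨ι, hι, dg, aug, h1, h2, h3, h4, h5⟩
    refine ⟨ι, hι, fun k => dg k + e, φ ∘ₗ aug, fun k => (hdeg _ _).2 (h1 k), ?_, ?_, ?_, ?_⟩
    · rw [LinearMap.range_comp, h2]
    · rintro d _ ⟨x, hx, rfl⟩ hd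
      rcases lt_or_ge d e with h | h
      · exact ⟨0, zero_mem _, by rw [hlow d x h hd, map_zero, map_zero]⟩
      · obtain ⟨d, rfl⟩ := Nat.exists_eq_add_of_le' h
        obtain ⟨y, hy, rfl⟩ := h3 d x hx ((hdeg d x).1 hd)
        exact ⟨y, mem_freeDeg_add_iff.2 hy, rfl⟩
    · intro j
      rcases lt_or_ge j e with h | h
      · rw [Finset.filter_false_of_mem]
        · simp
        · intro k _ hk
          simp only at hk
          omega
      · obtain ⟨j, rfl⟩ := Nat.exists_eq_add_of_le' h
        simp only [add_left_inj]
        exact (h4 j).trans (hb 0 j)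
    · have hk : LinearMap.ker (φ ∘ₗ aug) = (LinearMap.ker aug).map LinearMap.id := by
        rw [Submodule.map_id, LinearMap.ker_comp, LinearMap.ker_eq_bot.2 hinj, Submodule.comap_bot]
      rw [hk]
      refine ih LinearMap.id e Function.injective_id (fun d x => mem_freeDeg_add_iff)
        (fun d x hd hx => ?_) (fun i j => hb (i + 1) j) h5
      ext l α
      by_contra hne
      have := hx l α hne
      simp only at this
      omega

section Sum

variable {ι κ : Type}

/-- The first projection of a direct sum of free modules. -/
def sumFst (K : Type) [Field K] (n : ℕ) (ι κ : Type) :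
    ((ι ⊕ κ) →₀ SRing K n) →ₗ[SRing K n] (ι →₀ SRing K n) :=
  Finsupp.lcomapDomain Sum.inl Sum.inl_injective

/-- The second projection of a direct sum of free modules. -/
def sumSnd (K : Type) [Field K] (n : ℕ) (ι κ : Type) :
    ((ι ⊕ κ) →₀ SRing K n) →ₗ[SRing K n] (κ →₀ SRing K n) :=
  Finsupp.lcomapDomain Sum.inr Sum.inr_injective

/-- The element of a direct sum of free modules with given components. -/
def sumMk (y : ι →₀ SRing K n) (z : κ →₀ SRing K n) : (ι ⊕ κ) →₀ SRing K n :=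
  Finsupp.sumElim y z

lemma sumFst_mk (y : ι →₀ SRing K n) (z : κ →₀ SRing K n) : sumFst K n ι κ (sumMk y z) = y := by
  ext1 k
  rfl

lemma sumSnd_mk (y : ι →₀ SRing K n) (z : κ →₀ SRing K n) : sumSnd K n ι κ (sumMk y z) = z := by
  ext1 k
  rfl

lemma sum_ext {x x' : (ι ⊕ κ) →₀ SRing K n} (h1 : sumFst K n ι κ x = sumFst K n ι κ x')
    (h2 : sumSnd K n ι κ x = sumSnd K n ι κ x') : x = x' := by
  ext1 k
  cases k with
  | inl k => exact DFunLike.congr_fun h1 k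
  | inr k => exact DFunLike.congr_fun h2 k

/-- The first inclusion into a direct sum of free modules. -/
def sumInl (K : Type) [Field K] (n : ℕ) (ι κ : Type) :
    (ι →₀ SRing K n) →ₗ[SRing K n] ((ι ⊕ κ) →₀ SRing K n) where
  toFun y := sumMk y 0
  map_add' y z := sum_ext (by simp only [map_add, sumFst_mk]) (by simp only [map_add, sumSnd_mk,
    add_zero])
  map_smul' c y := sum_ext (by simp only [map_smul, sumFst_mk, RingHom.id_apply])
    (by simp only [map_smul, sumSnd_mk, smul_zero])

lemma mem_freeDeg_sum_iff {dg : ι → ℕ} {dg' : κ → ℕ} {d : ℕ} {x : (ι ⊕ κ) →₀ SRing K n} :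
    x ∈ freeDeg (Sum.elim dg dg') d ↔
      sumFst K n ι κ x ∈ freeDeg dg d ∧ sumSnd K n ι κ x ∈ freeDeg dg' d := by
  constructor
  · intro h
    exact ⟨fun k => h (Sum.inl k), fun k => h (Sum.inr k)⟩
  · rintro ⟨h1, h2⟩ (k | k)
    · exact h1 k
    · exact h2 k

lemma sumFst_single_inl (k : ι) :
    sumFst K n ι κ (Finsupp.single (Sum.inl k) 1) = Finsupp.single k 1 := by
  classical
  ext1 l
  change (Finsupp.single (Sum.inl k) 1 : (ι ⊕ κ) →₀ SRing K n) (Sum.inl l) = _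
  simp [Finsupp.single_apply]

lemma sumSnd_single_inl (k : ι) :
    sumSnd K n ι κ (Finsupp.single (Sum.inl k) 1) = 0 := by
  classical
  ext1 l
  change (Finsupp.single (Sum.inl k) 1 : (ι ⊕ κ) →₀ SRing K n) (Sum.inr l) = _
  simp

lemma sumFst_single_inr (k : κ) :
    sumFst K n ι κ (Finsupp.single (Sum.inr k) 1) = 0 := by
  classical
  ext1 l
  change (Finsupp.single (Sum.inr k) 1 : (ι ⊕ κ) →₀ SRing K n) (Sum.inl l) = _
  simp

lemma sumSnd_single_inr (k : κ) :
    sumSnd K n ι κ (Finsupp.single (Sum.inr k) 1) = Finsupp.single k 1 := by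
  classical
  ext1 l
  change (Finsupp.single (Sum.inr k) 1 : (ι ⊕ κ) →₀ SRing K n) (Sum.inr l) = _
  simp [Finsupp.single_apply]

lemma HasBound.inl {r : ℕ} {dg : ι → ℕ} {dg' : κ → ℕ} {N : Submodule (SRing K n) (ι →₀ SRing K n)}
    {b : ℕ → ℕ → ℕ∞} (h : HasBound K n r (freeDeg dg) N b) :
    HasBound K n r (freeDeg (Sum.elim dg dg')) (N.map (sumInl K n ι κ)) b := by
  refine HasBound.map (sumInl K n ι κ) 0 ?_ ?_ ?_ (fun i j => le_rfl) h
  · intro x y hxy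
    have := congrArg (sumFst K n ι κ) hxy
    exact (sumFst_mk x 0).symm.trans (this.trans (sumFst_mk y 0))
  · intro d x
    rw [add_zero, mem_freeDeg_sum_iff]
    exact ⟨fun h => (sumFst_mk x (0 : κ →₀ SRing K n)) ▸ h.1, fun h =>
      ⟨(sumFst_mk x (0 : κ →₀ SRing K n)).symm ▸ h,
        (sumSnd_mk x (0 : κ →₀ SRing K n)).symm ▸ zero_mem _⟩⟩
  · intro d x hd
    omega

lemma card_filter_sum [Fintype ι] [Fintype κ] (dg : ι → ℕ) (dg' : κ → ℕ) (j : ℕ) :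
    (Finset.univ.filter fun k => Sum.elim dg dg' k = j).card =
      (Finset.univ.filter fun k => dg k = j).card +
        (Finset.univ.filter fun k => dg' k = j).card := by
  simp only [Finset.card_filter, Fintype.sum_sum_type, Sum.elim_inl, Sum.elim_inr]
  rfl

end Sum

lemma linearCombination_mem {ι V : Type} [Fintype ι] [AddCommGroup V] [Module (SRing K n) V]
    {E : Submodule (SRing K n) V} {ε : ι → V} (h : ∀ k, ε k ∈ E) (y : ι →₀ SRing K n) :
    Finsupp.linearCombination (SRing K n) ε y ∈ E := by
  rw [Finsupp.linearCombination_apply]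
  exact Submodule.sum_mem _ fun k _ => Submodule.smul_mem _ _ (h k)

/-- The horseshoe lemma. -/
lemma HasBound.horseshoe {r : ℕ} : ∀ {V W : Type} [AddCommGroup V] [Module (SRing K n) V]
    [AddCommGroup W] [Module (SRing K n) W] {H : ℕ → AddSubgroup V} {H' : ℕ → AddSubgroup W}
    {E : Submodule (SRing K n) V} {C : Submodule (SRing K n) W} {a c : ℕ → ℕ → ℕ∞}
    (π : V →ₗ[SRing K n] W), IsGrading K n H →
    (∀ d, ∀ x ∈ H d, π x ∈ H' d) → (∀ x ∈ E, π x ∈ C) →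
    (∀ d, ∀ z ∈ C, z ∈ H' d → ∃ x ∈ E, x ∈ H d ∧ π x = z) →
    HasBound K n r H (E ⊓ LinearMap.ker π) a → HasBound K n r H' C c →
    HasBound K n r H E (fun i j => a i j + c i j) := by
  induction r with
  | zero => intros; trivial
  | succ r ih =>
    intro V W _ _ _ _ H H' E C a c π hH hπ hmap hlift
      ⟨ι, hι, dg, aug, h1, h2, h3, h4, h5⟩ ⟨κ, hκ, dg', aug', h1', h2', h3', h4', h5'⟩
    have haug : ∀ y, aug y ∈ E ⊓ LinearMap.ker π := fun y => h2 ▸ ⟨y, rfl⟩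
    have haug' : ∀ y, aug' y ∈ C := fun y => h2' ▸ ⟨y, rfl⟩
    choose ε hεE hεH hε using fun k => hlift (dg' k) _ (haug' (Finsupp.single k 1)) (h1' k)
    let lam := Finsupp.linearCombination (SRing K n) ε
    have hlamE : ∀ y, lam y ∈ E := linearCombination_mem hεE
    have hlamπ : ∀ y, π (lam y) = aug' y := by
      intro y
      have : π ∘ₗ lam = aug' := by
        refine Finsupp.lhom_ext' fun k => LinearMap.ext_ring ?_
        simp [lam, hε]
      exact LinearMap.congr_fun this y
    have hlamH : ∀ d, ∀ y ∈ freeDeg dg' d, lam y ∈ H d := fun d y hy =>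
      map_mem_of_mem_freeDeg hH lam (fun k => by simpa [lam] using hεH k) hy
    let tot := aug ∘ₗ sumFst K n ι κ + lam ∘ₗ sumSnd K n ι κ
    have htot : ∀ x, tot x = aug (sumFst K n ι κ x) + lam (sumSnd K n ι κ x) := fun x => rfl
    have hlift' : ∀ d, ∀ x ∈ E, x ∈ H d → ∃ y ∈ freeDeg (Sum.elim dg dg') d, tot y = x := by
      intro d x hx hd
      obtain ⟨z, hz, hzx⟩ := h3' d _ (hmap x hx) (hπ d x hd)
      obtain ⟨y, hy, hyx⟩ := h3 d (x - lam z)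
        ⟨sub_mem hx (hlamE z), by
          rw [SetLike.mem_coe, LinearMap.mem_ker, map_sub, hlamπ, hzx, sub_self]⟩
        (sub_mem hd (hlamH d z hz))
      refine ⟨sumMk y z, mem_freeDeg_sum_iff.2 ⟨?_, ?_⟩, ?_⟩
      · rwa [sumFst_mk]
      · rwa [sumSnd_mk]
      · rw [htot, sumFst_mk, sumSnd_mk, hyx, sub_add_cancel]
    refine ⟨ι ⊕ κ, inferInstance, Sum.elim dg dg', tot, ?_, ?_, hlift', ?_, ?_⟩
    · rintro (k | k)
      · rw [htot, sumFst_single_inl, sumSnd_single_inl, map_zero, add_zero]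
        exact h1 k
      · rw [htot, sumFst_single_inr, sumSnd_single_inr, map_zero, zero_add]
        simpa [lam] using hεH k
    · apply le_antisymm
      · rintro _ ⟨y, rfl⟩
        exact add_mem (haug _).1 (hlamE _)
      · intro x hx
        have hx' := hmap x hx
        rw [← h2'] at hx'
        obtain ⟨z, hz⟩ := hx'
        have hxz : x - lam z ∈ E ⊓ LinearMap.ker π :=
          ⟨sub_mem hx (hlamE z), by
            rw [SetLike.mem_coe, LinearMap.mem_ker, map_sub, hlamπ, hz, sub_self]⟩
        rw [← h2] at hxz
        obtain ⟨y, hy⟩ := hxz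
        exact ⟨sumMk y z, by rw [htot, sumFst_mk, sumSnd_mk, hy, sub_add_cancel]⟩
    · intro j
      rw [card_filter_sum, Nat.cast_add]
      exact add_le_add (h4 j) (h4' j)
    · refine ih (sumSnd K n ι κ) (isGrading_freeDeg _) (fun d x hx => (mem_freeDeg_sum_iff.1 hx).2)
        (C := LinearMap.ker aug') ?_ ?_ ?_ h5'
      · intro x hx
        rw [LinearMap.mem_ker] at hx ⊢
        have := congrArg π hx
        rw [htot, map_add, hlamπ, LinearMap.mem_ker.1 (haug _).2, zero_add, map_zero] at this
        exact this
      · intro d z hz hd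
        obtain ⟨y, hy, hyz⟩ := h3 d (-lam z)
          ⟨neg_mem (hlamE z), by
            rw [SetLike.mem_coe, LinearMap.mem_ker, map_neg, hlamπ, LinearMap.mem_ker.1 hz,
              neg_zero]⟩
          (neg_mem (hlamH d z hd))
        refine ⟨sumMk y z, ?_, mem_freeDeg_sum_iff.2 ⟨?_, ?_⟩, sumSnd_mk y z⟩
        · rw [LinearMap.mem_ker, htot, sumFst_mk, sumSnd_mk, hyz, neg_add_cancel]
        · rwa [sumFst_mk]
        · rwa [sumSnd_mk]
      · have : LinearMap.ker tot ⊓ LinearMap.ker (sumSnd K n ι κ) =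
            (LinearMap.ker aug).map (sumInl K n ι κ) := by
          ext x
          constructor
          · rintro ⟨hx1, hx2⟩
            rw [SetLike.mem_coe, LinearMap.mem_ker] at hx1 hx2
            rw [htot, hx2, map_zero, add_zero] at hx1
            exact ⟨_, hx1, sum_ext (sumFst_mk _ _) ((sumSnd_mk _ _).trans hx2.symm)⟩
          · rintro ⟨y, hy, rfl⟩
            have e1 : sumFst K n ι κ (sumInl K n ι κ y) = y := sumFst_mk y 0
            have e2 : sumSnd K n ι κ (sumInl K n ι κ y) = 0 := sumSnd_mk y 0
            refine ⟨?_, e2⟩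
            rw [SetLike.mem_coe, LinearMap.mem_ker, htot, e1, e2, map_zero, add_zero]
            exact hy
        rw [this]
        exact HasBound.inl h5

/-- The mapping cone bound for a sum of two ideals. -/
lemma HasBound.sup {r : ℕ} {A B : Submodule (SRing K n) (SRing K n)} {a b c : ℕ → ℕ → ℕ∞}
    (hA : HasBound K n (r + 1) (ringDeg K n 0) A a) (hB : HasBound K n (r + 1) (ringDeg K n 0) B b)
    (hC : HasBound K n r (ringDeg K n 0) (A ⊓ B) c) :
    HasBound K n (r + 1) (ringDeg K n 0) (A ⊔ B)
      (fun i j => a i j + b i j + if i = 0 then 0 else c (i - 1) j) := by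
  obtain ⟨ι, hι, dg, aug, h1, h2, h3, h4, h5⟩ := hA
  obtain ⟨κ, hκ, dg', aug', h1', h2', h3', h4', h5'⟩ := hB
  have haug : ∀ y, aug y ∈ A := fun y => h2 ▸ ⟨y, rfl⟩
  have haug' : ∀ y, aug' y ∈ B := fun y => h2' ▸ ⟨y, rfl⟩
  let tot := aug ∘ₗ sumFst K n ι κ + aug' ∘ₗ sumSnd K n ι κ
  have htot : ∀ x, tot x = aug (sumFst K n ι κ x) + aug' (sumSnd K n ι κ x) := fun x => rfl
  have hdeg : ∀ k, tot (Finsupp.single k 1) ∈ ringDeg K n 0 (Sum.elim dg dg' k) := by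
    rintro (k | k)
    · rw [htot, sumFst_single_inl, sumSnd_single_inl, map_zero, add_zero]
      exact h1 k
    · rw [htot, sumFst_single_inr, sumSnd_single_inr, map_zero, zero_add]
      exact h1' k
  have hrange : LinearMap.range tot = A ⊔ B := by
    apply le_antisymm
    · rintro _ ⟨y, rfl⟩
      exact Submodule.add_mem_sup (haug _) (haug' _)
    · intro x hx
      obtain ⟨u, hu, w, hw, rfl⟩ := Submodule.mem_sup.1 hx
      rw [← h2] at hu
      rw [← h2'] at hw
      obtain ⟨y, rfl⟩ := hu
      obtain ⟨z, rfl⟩ := hw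
      exact ⟨sumMk y z, by rw [htot, sumFst_mk, sumSnd_mk]⟩
  refine ⟨ι ⊕ κ, inferInstance, Sum.elim dg dg', tot, hdeg, hrange, ?_, ?_, ?_⟩
  · intro d x hx hd
    exact exists_homogeneous_lift_ring tot hdeg (hrange ▸ hx) hd
  · intro j
    simp only [if_true, add_zero]
    rw [card_filter_sum, Nat.cast_add]
    exact add_le_add (h4 j) (h4' j)
  · simp only [Nat.add_eq_zero_iff, one_ne_zero, and_false, if_false, Nat.add_sub_cancel]
    refine HasBound.horseshoe (aug ∘ₗ sumFst K n ι κ) (isGrading_freeDeg _)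
      (fun d x hx => map_mem_of_mem_freeDeg (isGrading_ringDeg 0) aug h1
        (mem_freeDeg_sum_iff.1 hx).1) ?_ ?_ ?_ hC
    · intro x hx
      rw [LinearMap.mem_ker, htot] at hx
      refine ⟨haug _, ?_⟩
      rw [LinearMap.comp_apply, eq_neg_of_add_eq_zero_left hx]
      exact neg_mem (haug' _)
    · rintro d z ⟨hzA, hzB⟩ hd
      obtain ⟨y, hy, hyz⟩ := h3 d z hzA hd
      obtain ⟨y', hy', hyz'⟩ := h3' d (-z) (neg_mem hzB) (neg_mem hd)
      refine ⟨sumMk y y', ?_, mem_freeDeg_sum_iff.2 ⟨?_, ?_⟩, ?_⟩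
      · rw [LinearMap.mem_ker, htot, sumFst_mk, sumSnd_mk, hyz, hyz', add_neg_cancel]
      · rwa [sumFst_mk]
      · rwa [sumSnd_mk]
      · rw [LinearMap.comp_apply, sumFst_mk, hyz]
    · refine HasBound.horseshoe (sumSnd K n ι κ) (isGrading_freeDeg _)
        (fun d x hx => (mem_freeDeg_sum_iff.1 hx).2) (C := LinearMap.ker aug') ?_ ?_ ?_ h5'
      · rintro x ⟨hx1, hx2⟩
        rw [SetLike.mem_coe, LinearMap.mem_ker] at hx1 hx2
        rw [LinearMap.comp_apply] at hx2
        rwa [htot, hx2, zero_add] at hx1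
      · intro d z hz hd
        refine ⟨sumMk 0 z, ⟨?_, ?_⟩, mem_freeDeg_sum_iff.2 ⟨?_, ?_⟩, sumSnd_mk 0 z⟩
        · rw [SetLike.mem_coe, LinearMap.mem_ker, htot, sumFst_mk, sumSnd_mk, map_zero, zero_add]
          exact hz
        · rw [SetLike.mem_coe, LinearMap.mem_ker, LinearMap.comp_apply, sumFst_mk, map_zero]
        · rw [sumFst_mk]; exact zero_mem _
        · rwa [sumSnd_mk]
      · have : LinearMap.ker tot ⊓ LinearMap.ker (aug ∘ₗ sumFst K n ι κ) ⊓
            LinearMap.ker (sumSnd K n ι κ) = (LinearMap.ker aug).map (sumInl K n ι κ) := by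
          ext x
          constructor
          · rintro ⟨⟨-, hx1⟩, hx2⟩
            exact ⟨_, hx1, sum_ext (sumFst_mk _ _)
              ((sumSnd_mk _ _).trans (LinearMap.mem_ker.1 hx2).symm)⟩
          · rintro ⟨y, hy, rfl⟩
            have e1 : sumFst K n ι κ (sumInl K n ι κ y) = y := sumFst_mk y 0
            have e2 : sumSnd K n ι κ (sumInl K n ι κ y) = 0 := sumSnd_mk y 0
            refine ⟨⟨?_, ?_⟩, e2⟩
            · rw [SetLike.mem_coe, LinearMap.mem_ker, htot, e1, e2, map_zero, add_zero]
              exact hy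
            · rw [SetLike.mem_coe, LinearMap.mem_ker, LinearMap.comp_apply, e1]
              exact hy
        rw [this]
        exact HasBound.inl h5

end UpperBound

section MonomialIdeals

variable {K : Type} [Field K] {n : ℕ}

/-- The ideal `J` consists of the polynomials all of whose exponents satisfy `P`. -/
def IsMono (J : Submodule (SRing K n) (SRing K n)) (P : (Fin n →₀ ℕ) → Prop) : Prop :=
  ∀ f, f ∈ J ↔ ∀ α, coeff α f ≠ 0 → P α

lemma IsMono.eq {J J' : Submodule (SRing K n) (SRing K n)} {P P' : (Fin n →₀ ℕ) → Prop}
    (h : IsMono J P) (h' : IsMono J' P') (hP : ∀ α, P α ↔ P' α) : J = J' := by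
  ext f
  rw [h, h']
  exact forall₂_congr fun α _ => hP α

lemma IsMono.inf {A B : Submodule (SRing K n) (SRing K n)} {P Q : (Fin n →₀ ℕ) → Prop}
    (hA : IsMono A P) (hB : IsMono B Q) : IsMono (A ⊓ B) (fun α => P α ∧ Q α) := by
  intro f
  rw [Submodule.mem_inf, hA, hB]
  exact ⟨fun h α hα => ⟨h.1 α hα, h.2 α hα⟩, fun h => ⟨fun α hα => (h α hα).1,
    fun α hα => (h α hα).2⟩⟩

lemma IsMono.sup {A B : Submodule (SRing K n) (SRing K n)} {P Q : (Fin n →₀ ℕ) → Prop}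
    (hA : IsMono A P) (hB : IsMono B Q) : IsMono (A ⊔ B) (fun α => P α ∨ Q α) := by
  classical
  intro f
  constructor
  · intro hf α hα
    obtain ⟨g, hg, h, hh, rfl⟩ := Submodule.mem_sup.1 hf
    by_cases h0 : coeff α g = 0
    · right
      refine (hB h).1 hh α fun h1 => hα ?_
      rw [coeff_add, h0, h1, add_zero]
    · exact Or.inl ((hA g).1 hg α h0)
  · intro hf
    obtain ⟨g, hg⟩ := exists_coeff_ite P f
    have hgA : g ∈ A := (hA g).2 fun α hα => by
      by_contra hP
      exact hα (by rw [hg, if_neg hP])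
    have hgB : f - g ∈ B := (hB _).2 fun α hα => by
      rw [coeff_sub, hg] at hα
      by_cases hP : P α
      · rw [if_pos hP, sub_self] at hα
        exact absurd rfl hα
      · rw [if_neg hP, sub_zero] at hα
        exact (hf α hα).resolve_left hP
    exact Submodule.mem_sup.2 ⟨g, hgA, f - g, hgB, add_sub_cancel _ _⟩

/-- The exponents of `X v` times a monomial with exponent satisfying `P`. -/
def shiftPred (v : Fin n) (P : (Fin n →₀ ℕ) → Prop) (α : Fin n →₀ ℕ) : Prop :=
  α v ≠ 0 ∧ P (α - Finsupp.single v 1)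

lemma IsMono.map_mulLeft {A : Submodule (SRing K n) (SRing K n)} {P : (Fin n →₀ ℕ) → Prop}
    (hA : IsMono A P) (v : Fin n) :
    IsMono (A.map (LinearMap.mulLeft (SRing K n) (X v))) (shiftPred v P) := by
  classical
  intro f
  constructor
  · rintro ⟨g, hg, rfl⟩ α hα
    rw [LinearMap.mulLeft_apply, coeff_X_mul'] at hα
    split_ifs at hα with h
    · exact ⟨Finsupp.mem_support_iff.1 h, (hA g).1 hg _ hα⟩
    · exact absurd rfl hα
  · intro hf
    have : (X v : SRing K n) ∣ f := by
      rw [X_dvd_iff_modMonomial_eq_zero]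
      ext α
      by_cases hv : α v = 0
      · rw [coeff_modMonomial_of_not_le, coeff_zero]
        · by_contra hne
          exact (hf α hne).1 hv
        · rw [Finsupp.single_le_iff]
          omega
      · rw [coeff_modMonomial_of_le, coeff_zero]
        rw [Finsupp.single_le_iff]
        omega
    obtain ⟨g, rfl⟩ := this
    refine ⟨g, (hA g).2 fun α hα => ?_, rfl⟩
    have := (hf (Finsupp.single v 1 + α) (by rwa [coeff_X_mul])).2
    rwa [add_tsub_cancel_left] at this

/-- Bounds after shifting all degrees by one. -/
def shiftBound (b : ℕ → ℕ → ℕ∞) (i j : ℕ) : ℕ∞ := if j = 0 then 0 else b i (j - 1)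

lemma HasBound.map_mulLeft {r : ℕ} {A : Submodule (SRing K n) (SRing K n)} {b : ℕ → ℕ → ℕ∞}
    (hA : HasBound K n r (ringDeg K n 0) A b) (v : Fin n) :
    HasBound K n r (ringDeg K n 0) (A.map (LinearMap.mulLeft (SRing K n) (X v)))
      (shiftBound b) := by
  classical
  refine HasBound.map (LinearMap.mulLeft (SRing K n) (X v)) 1 ?_ ?_ ?_ ?_ hA
  · intro f g hfg
    exact mul_left_cancel₀ (X_ne_zero v) hfg
  · intro d f
    rw [LinearMap.mulLeft_apply]
    constructor
    · intro h α hα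
      have := h (Finsupp.single v 1 + α) (by rwa [coeff_X_mul])
      rw [map_add, Finsupp.degree_single] at this
      omega
    · intro h
      rw [add_comm]
      exact ringDeg_mul (X_mem_ringDeg v) h
  · intro d f hd h
    ext α
    by_contra hne
    have := h (Finsupp.single v 1 + α) (by rwa [LinearMap.mulLeft_apply, coeff_X_mul])
    rw [map_add, Finsupp.degree_single] at this
    omega
  · intro i j
    simp [shiftBound]

/-- The linear bound: generators in position `i` only in degree `i + c`. -/
def linBound (c i j : ℕ) : ℕ∞ := if j = i + c then ⊤ else 0

/-- There is an ideal with exponents `P` whose graded Betti numbers are bounded by `b`. -/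
def PredBound (K : Type) [Field K] (n : ℕ) (P : (Fin n →₀ ℕ) → Prop)
    (b : ℕ → ℕ → ℕ∞) : Prop :=
  ∃ J : Submodule (SRing K n) (SRing K n), IsMono J P ∧ ∀ r, HasBound K n r (ringDeg K n 0) J b

lemma PredBound.congr {P Q : (Fin n →₀ ℕ) → Prop} {b b' : ℕ → ℕ → ℕ∞}
    (h : PredBound K n P b) (hP : ∀ α, P α ↔ Q α) (hb : ∀ i j, b i j ≤ b' i j) :
    PredBound K n Q b' := by
  obtain ⟨J, hJ, h⟩ := h
  refine ⟨J, fun f => ?_, fun r => (h r).mono hb⟩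
  rw [hJ]
  exact forall₂_congr fun α _ => hP α

lemma PredBound.shift {P : (Fin n →₀ ℕ) → Prop} {b : ℕ → ℕ → ℕ∞}
    (h : PredBound K n P b) (v : Fin n) : PredBound K n (shiftPred v P) (shiftBound b) := by
  obtain ⟨J, hJ, h⟩ := h
  exact ⟨_, hJ.map_mulLeft v, fun r => (h r).map_mulLeft v⟩

lemma PredBound.false {b : ℕ → ℕ → ℕ∞} : PredBound K n (fun _ => False) b := by
  refine ⟨⊥, fun f => ?_, fun r => HasBound.bot rfl⟩
  rw [Submodule.mem_bot, MvPolynomial.ext_iff]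
  exact forall_congr' fun α => by simp

lemma PredBound.true :
    PredBound K n (fun _ => True) (fun i j => if i = 0 ∧ j = 0 then 1 else 0) := by
  refine ⟨⊤, fun f => by simp, fun r => ?_⟩
  cases r with
  | zero => trivial
  | succ r =>
    have hinj : ∀ y : Unit →₀ SRing K n, Finsupp.lapply (R := SRing K n) () y = 0 → y = 0 :=
      fun y hy => Finsupp.ext fun _ => hy
    refine ⟨Unit, inferInstance, fun _ => 0, Finsupp.lapply (), fun k => ?_, ?_, ?_, ?_,
      HasBound.bot ?_⟩
    · rw [Finsupp.lapply_apply, Finsupp.single_eq_same]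
      exact one_mem_ringDeg 0
    · rw [LinearMap.range_eq_top]
      intro f
      exact ⟨Finsupp.single () f, by simp⟩
    · intro d f _ hd
      exact ⟨Finsupp.single () f, single_mem_freeDeg hd, by simp⟩
    · intro j
      by_cases hj : j = 0
      · simp [hj]
      · simp [hj, Ne.symm hj]
    · rw [Submodule.eq_bot_iff]
      exact hinj

lemma PredBound.sup {P Q R T : (Fin n →₀ ℕ) → Prop} {a b c d : ℕ → ℕ → ℕ∞}
    (hP : PredBound K n P a) (hQ : PredBound K n Q b) (hR : PredBound K n R c)
    (hPQ : ∀ α, P α ∧ Q α ↔ R α) (hT : ∀ α, P α ∨ Q α ↔ T α)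
    (hd : ∀ i j, a i j + b i j + (if i = 0 then 0 else c (i - 1) j) ≤ d i j) :
    PredBound K n T d := by
  obtain ⟨A, hA, hA'⟩ := hP
  obtain ⟨B, hB, hB'⟩ := hQ
  obtain ⟨C, hC, hC'⟩ := hR
  obtain rfl := (hA.inf hB).eq hC hPQ
  refine PredBound.congr ⟨_, hA.sup hB, fun r => ?_⟩ hT hd
  cases r with
  | zero => trivial
  | succ r => exact HasBound.sup (hA' _) (hB' _) (hC' _)

lemma sub_single_apply_of_ne {u v : Fin n} (h : u ≠ v) (α : Fin n →₀ ℕ) :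
    (α - Finsupp.single v 1 : Fin n →₀ ℕ) u = α u := by
  rw [Finsupp.tsub_apply, Finsupp.single_eq_of_ne h, Nat.sub_zero]

lemma add_linBound_le {c i j : ℕ} {a : ℕ∞} (h : j ≠ i + c → a = 0) :
    a ≤ linBound c i j := by
  unfold linBound
  split_ifs with hj
  · exact le_top
  · rw [h hj]

/-- Multiplying a `c`-linear ideal by a variable and adding it to a `(c + 1)`-linear one. -/
lemma PredBound.sup_shift {P Q R T : (Fin n →₀ ℕ) → Prop} {c : ℕ} {v : Fin n}
    (hP : PredBound K n P (linBound (c + 1))) (hQ : PredBound K n Q (linBound c))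
    (hR : PredBound K n R (linBound (c + 1)))
    (hPQ : ∀ α, P α ∧ shiftPred v Q α ↔ shiftPred v R α)
    (hT : ∀ α, P α ∨ shiftPred v Q α ↔ T α) : PredBound K n T (linBound (c + 1)) := by
  refine PredBound.sup hP (hQ.shift v) (hR.shift v) hPQ hT fun i j => add_linBound_le fun hj => ?_
  simp only [linBound, shiftBound]
  split_ifs <;> first | (exfalso; omega) | simp

/-- An ideal generated by variables has a linear resolution. -/
lemma predBound_vars (N : Finset (Fin n)) :
    PredBound K n (fun α => ∃ u ∈ N, α u ≠ 0) (linBound 1) := by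
  classical
  induction N using Finset.induction_on with
  | empty => exact PredBound.false.congr (by simp) fun i j => le_rfl
  | insert v N hv ih =>
    have hne : ∀ u ∈ N, u ≠ v := fun u hu e => hv (e ▸ hu)
    refine PredBound.sup (b := shiftBound fun i j => if i = 0 ∧ j = 0 then 1 else 0)
      ih (PredBound.true.shift v) (ih.shift v) ?_ ?_ fun i j => add_linBound_le fun hj => ?_
    · intro α
      constructor
      · rintro ⟨⟨u, hu, h⟩, hv', -⟩
        exact ⟨hv', u, hu, by rwa [sub_single_apply_of_ne (hne u hu)]⟩
      · rintro ⟨hv', u, hu, h⟩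
        exact ⟨⟨u, hu, by rwa [sub_single_apply_of_ne (hne u hu)] at h⟩, hv', trivial⟩
    · intro α
      simp only [shiftPred, and_true, Finset.mem_insert, exists_eq_or_imp]
      exact or_comm
    · simp only [linBound, shiftBound]
      split_ifs <;> first | (exfalso; omega) | simp

end MonomialIdeals

section Conversion

variable {K : Type} [Field K] {n : ℕ}

lemma HasBound.exists_fin {r : ℕ} {V : Type} [AddCommGroup V] [Module (SRing K n) V]
    {H : ℕ → AddSubgroup V} {M : Submodule (SRing K n) V} {b : ℕ → ℕ → ℕ∞}
    (h : HasBound K n (r + 1) H M b) :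
    ∃ (s : ℕ) (dg : Fin s → ℕ) (aug : (Fin s →₀ SRing K n) →ₗ[SRing K n] V),
      (∀ k, aug (Finsupp.single k 1) ∈ H (dg k)) ∧ LinearMap.range aug = M ∧
      (∀ j, ((Finset.univ.filter fun k => dg k = j).card : ℕ∞) ≤ b 0 j) ∧
      HasBound K n r (freeDeg dg) (LinearMap.ker aug) (fun i => b (i + 1)) := by
  obtain ⟨ι, hι, dg, aug, h1, h2, -, h4, h5⟩ := h
  let e := Fintype.equivFin ι
  let L : (Fin (Fintype.card ι) →₀ SRing K n) ≃ₗ[SRing K n] (ι →₀ SRing K n) :=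
    Finsupp.domLCongr e.symm
  refine ⟨Fintype.card ι, dg ∘ e.symm, aug ∘ₗ L.toLinearMap, fun k => ?_, ?_, fun j => ?_, ?_⟩
  · have : L (Finsupp.single k 1) = Finsupp.single (e.symm k) 1 := Finsupp.domLCongr_single _ _ _
    rw [LinearMap.comp_apply, LinearEquiv.coe_coe, this]
    exact h1 _
  · rw [LinearMap.range_comp, LinearEquiv.range, Submodule.map_top, h2]
  · refine le_of_eq_of_le ?_ (h4 j)
    rw [Finset.card_filter, Finset.card_filter]
    exact congrArg _ (Equiv.sum_comp e.symm fun k => if dg k = j then 1 else 0)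
  · have hk : LinearMap.ker (aug ∘ₗ L.toLinearMap) =
        (LinearMap.ker aug).map L.symm.toLinearMap := by
      rw [LinearMap.ker_comp]
      exact (Submodule.map_equiv_eq_comap_symm L.symm _).symm
    rw [hk]
    refine HasBound.map L.symm.toLinearMap 0 L.symm.injective (fun d x => ?_) (fun d x hd => ?_)
      (fun i j => le_rfl) h5
    · have hx : ∀ k, L.symm x k = x (e.symm k) := fun k => rfl
      rw [mem_freeDeg, mem_freeDeg]
      exact ⟨fun h l => by simpa [hx] using h (e l), fun h l => h (e.symm l)⟩
    · omega

lemma HasBound.exists_resolution {r : ℕ} : ∀ {V : Type} [AddCommGroup V] [Module (SRing K n) V]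
    {H : ℕ → AddSubgroup V} {M : Submodule (SRing K n) V} {b : ℕ → ℕ → ℕ∞},
    HasBound K n (r + 1) H M b →
    ∃ (s : ℕ → ℕ) (dg : ∀ i, Fin (s i) → ℕ) (aug : (Fin (s 0) →₀ SRing K n) →ₗ[SRing K n] V)
      (diff : ∀ i, (Fin (s (i + 1)) →₀ SRing K n) →ₗ[SRing K n] (Fin (s i) →₀ SRing K n)),
      (∀ k, aug (Finsupp.single k 1) ∈ H (dg 0 k)) ∧
      (∀ i k, diff i (Finsupp.single k 1) ∈ freeDeg (dg i) (dg (i + 1) k)) ∧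
      LinearMap.range aug = M ∧ (0 < r → LinearMap.range (diff 0) = LinearMap.ker aug) ∧
      (∀ i, i + 1 < r → LinearMap.range (diff (i + 1)) = LinearMap.ker (diff i)) ∧
      ∀ i j, i ≤ r → ((Finset.univ.filter fun k => dg i k = j).card : ℕ∞) ≤ b i j := by
  induction r with
  | zero =>
    intro V _ _ H M b h
    obtain ⟨s, dg, aug, h1, h2, h3, -⟩ := h.exists_fin
    refine ⟨fun i => match i with | 0 => s | _ + 1 => 0,
      fun i => match i with | 0 => dg | _ + 1 => Fin.elim0, aug, fun _ => 0, h1,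
      fun i k => k.elim0, h2, fun h => absurd h (lt_irrefl 0), fun i h => by omega, ?_⟩
    intro i j hi
    obtain rfl := Nat.le_zero.1 hi
    exact h3 j
  | succ r ih =>
    intro V _ _ H M b h
    obtain ⟨s, dg, aug, h1, h2, h3, h4⟩ := h.exists_fin
    obtain ⟨s', dg', aug', diff', h1', h2', h3', h4', h5', h6'⟩ := ih h4
    refine ⟨fun i => match i with | 0 => s | i + 1 => s' i,
      fun i => match i with | 0 => dg | i + 1 => dg' i, aug,
      fun i => match i with | 0 => aug' | i + 1 => diff' i, h1, ?_, h2, fun _ => h3', ?_, ?_⟩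
    · rintro (_ | i) k
      · exact h1' k
      · exact h2' i k
    · rintro (_ | i) hi
      · exact h4' (by omega)
      · exact h5' i (by omega)
    · rintro (_ | i) j hi
      · exact h3 j
      · exact h6' i j (by omega)

lemma HasBound.gradedBetti_le {I : Ideal (SRing K n)} {b : ℕ → ℕ → ℕ∞} {i : ℕ} (j : ℕ)
    (h : HasBound K n (i + 2) (ringDeg K n 0) I b) : gradedBetti I i j ≤ b i j := by
  obtain ⟨s, dg, aug, diff, h1, h2, h3, h4, h5, h6⟩ := h.exists_resolution
  let R : GradedPartialRes I ((i : ℕ∞) + 1) :=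
    { s := s
      dg := dg
      aug := aug
      diff := diff
      aug_hom := fun k => isHomogeneous_iff_mem_ringDeg.2 (h1 k)
      diff_hom := fun i k l => mem_ringDeg_iff.1 (h2 i k l)
      aug_range := h3
      exact_zero := fun _ => h4 (Nat.succ_pos i)
      exact_succ := fun i' hi => h5 i' (by exact_mod_cast hi) }
  exact (iInf_le _ R).trans (h6 i j (Nat.le_succ i))

lemma PredBound.gradedBetti_le {G : SimpleGraph (Fin n)} {P : (Fin n →₀ ℕ) → Prop}
    {b : ℕ → ℕ → ℕ∞} (h : PredBound K n P b)
    (hP : ∀ α, P α ↔ ∃ i j, G.Adj i j ∧ α i ≠ 0 ∧ α j ≠ 0) (i j : ℕ) :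
    gradedBetti (edgeIdeal K G.Adj) i j ≤ b i j := by
  obtain ⟨J, hJ, h⟩ := h
  obtain rfl : J = edgeIdeal K G.Adj := hJ.eq (fun f => mem_edgeIdeal_iff) hP
  exact (h _).gradedBetti_le j

end Conversion

section Linear

variable {K : Type} [Field K] {n : ℕ}

/-- The exponents of the monomials in the edge ideal of the subgraph of `G` induced on `V`. -/
def edgePred (G : SimpleGraph (Fin n)) (V : Finset (Fin n)) (α : Fin n →₀ ℕ) : Prop :=
  ∃ i j, i ∈ V ∧ j ∈ V ∧ G.Adj i j ∧ α i ≠ 0 ∧ α j ≠ 0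

/-- The vertex `v` is simplicial in the complement of `G` restricted to `V`. -/
def IsCosimplicial (G : SimpleGraph (Fin n)) (V : Finset (Fin n)) (v : Fin n) : Prop :=
  v ∈ V ∧ ∀ u ∈ V, ∀ w ∈ V, u ≠ v → w ≠ v → ¬ G.Adj v u → ¬ G.Adj v w → ¬ G.Adj u w

lemma IsCosimplicial.predBound {G : SimpleGraph (Fin n)} {V : Finset (Fin n)} {v : Fin n}
    (hv : IsCosimplicial G V v) (h : PredBound K n (edgePred G (V.erase v)) (linBound 2)) :
    PredBound K n (edgePred G V) (linBound 2) := by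
  classical
  refine PredBound.sup_shift (v := v) h (predBound_vars (V.filter (G.Adj v))) h ?_ ?_
  · intro α
    constructor
    · rintro ⟨⟨i, j, hi, hj, hij, hi', hj'⟩, hv', -⟩
      refine ⟨hv', i, j, hi, hj, hij, ?_, ?_⟩
      · rwa [sub_single_apply_of_ne (Finset.ne_of_mem_erase hi)]
      · rwa [sub_single_apply_of_ne (Finset.ne_of_mem_erase hj)]
    · rintro ⟨hv', i, j, hi, hj, hij, hi', hj'⟩
      have key : G.Adj v i ∨ G.Adj v j := by
        by_contra! hne
        exact hv.2 i (Finset.mem_of_mem_erase hi) j (Finset.mem_of_mem_erase hj)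
          (Finset.ne_of_mem_erase hi) (Finset.ne_of_mem_erase hj) hne.1 hne.2 hij
      refine ⟨⟨i, j, hi, hj, hij, ?_, ?_⟩, hv', ?_⟩
      · rwa [sub_single_apply_of_ne (Finset.ne_of_mem_erase hi)] at hi'
      · rwa [sub_single_apply_of_ne (Finset.ne_of_mem_erase hj)] at hj'
      · rcases key with key | key
        · exact ⟨i, Finset.mem_filter.2 ⟨Finset.mem_of_mem_erase hi, key⟩, hi'⟩
        · exact ⟨j, Finset.mem_filter.2 ⟨Finset.mem_of_mem_erase hj, key⟩, hj'⟩
  · intro α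
    constructor
    · rintro (⟨i, j, hi, hj, h⟩ | ⟨hv', u, hu, h⟩)
      · exact ⟨i, j, Finset.mem_of_mem_erase hi, Finset.mem_of_mem_erase hj, h⟩
      · rw [Finset.mem_filter] at hu
        rw [sub_single_apply_of_ne hu.2.ne'] at h
        exact ⟨v, u, hv.1, hu.1, hu.2, hv', h⟩
    · rintro ⟨i, j, hi, hj, hij, hi', hj'⟩
      by_cases h1 : i = v
      · subst h1
        exact Or.inr ⟨hi', j, Finset.mem_filter.2 ⟨hj, hij⟩,
          by rwa [sub_single_apply_of_ne hij.ne']⟩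
      · by_cases h2 : j = v
        · subst h2
          exact Or.inr ⟨hj', i, Finset.mem_filter.2 ⟨hi, hij.symm⟩,
            by rwa [sub_single_apply_of_ne hij.ne]⟩
        · exact Or.inl ⟨i, j, Finset.mem_erase.2 ⟨h1, hi⟩, Finset.mem_erase.2 ⟨h2, hj⟩,
            hij, hi', hj'⟩

/-- Edge ideals of complements of graphs with a simplicial elimination order have linear
resolutions. -/
lemma predBound_edgePred {G : SimpleGraph (Fin n)}
    (h : ∀ V : Finset (Fin n), V.Nonempty → ∃ v, IsCosimplicial G V v) (V : Finset (Fin n)) :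
    PredBound K n (edgePred G V) (linBound 2) := by
  classical
  induction V using Finset.strongInduction with
  | H V ih =>
    rcases V.eq_empty_or_nonempty with rfl | hV
    · exact PredBound.false.congr (by simp [edgePred]) fun i j => le_rfl
    · obtain ⟨v, hv⟩ := h V hV
      exact hv.predBound (ih _ (Finset.erase_ssubset hv.1))

end Linear

section Cycle

variable {K : Type} [Field K] {n : ℕ} {q : ℕ → Fin n}

/-- The exponents of the edge ideal of the complement of a path with `m` vertices. -/
def pathPred (q : ℕ → Fin n) (m : ℕ) (α : Fin n →₀ ℕ) : Prop :=
  ∃ i j, i + 2 ≤ j ∧ j < m ∧ α (q i) ≠ 0 ∧ α (q j) ≠ 0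

/-- The exponents of the edge ideal of the complement of a cycle with `m` vertices. -/
def cyclePred (q : ℕ → Fin n) (m : ℕ) (α : Fin n →₀ ℕ) : Prop :=
  ∃ i j, i + 2 ≤ j ∧ j < m ∧ ¬ (i = 0 ∧ j + 1 = m) ∧ α (q i) ≠ 0 ∧ α (q j) ≠ 0

lemma ne_of_injOn {m i j : ℕ} (hq : Set.InjOn q (Set.Iio m)) (hi : i < m) (hj : j < m)
    (hij : i ≠ j) : q i ≠ q j := fun e => hij (hq hi hj e)

lemma predBound_pathPred (m : ℕ) (hq : Set.InjOn q (Set.Iio m)) :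
    PredBound K n (pathPred q m) (linBound 2) := by
  classical
  induction m with
  | zero => exact PredBound.false.congr (by simp [pathPred]) fun i j => le_rfl
  | succ m ih =>
    have hne : ∀ i < m, q i ≠ q m := fun i hi =>
      ne_of_injOn hq (by omega) (by omega) (by omega)
    have h := ih (hq.mono fun i hi => Nat.lt_succ_of_lt hi)
    refine PredBound.sup_shift (v := q m) h (predBound_vars ((Finset.range (m - 1)).image q)) h
      ?_ ?_
    · intro α
      constructor
      · rintro ⟨⟨i, j, hij, hj, hi', hj'⟩, hv, -⟩
        refine ⟨hv, i, j, hij, hj, ?_, ?_⟩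
        · rwa [sub_single_apply_of_ne (hne i (by omega))]
        · rwa [sub_single_apply_of_ne (hne j hj)]
      · rintro ⟨hv, i, j, hij, hj, hi', hj'⟩
        refine ⟨⟨i, j, hij, hj, ?_, ?_⟩, hv, q i,
          Finset.mem_image_of_mem q (Finset.mem_range.2 (by omega)), hi'⟩
        · rwa [sub_single_apply_of_ne (hne i (by omega))] at hi'
        · rwa [sub_single_apply_of_ne (hne j hj)] at hj'
    · intro α
      constructor
      · rintro (⟨i, j, hij, hj, h⟩ | ⟨hv, u, hu, h⟩)
        · exact ⟨i, j, hij, by omega, h⟩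
        · obtain ⟨i, hi, rfl⟩ := Finset.mem_image.1 hu
          rw [Finset.mem_range] at hi
          rw [sub_single_apply_of_ne (hne i (by omega))] at h
          exact ⟨i, m, by omega, by omega, h, hv⟩
      · rintro ⟨i, j, hij, hj, hi', hj'⟩
        rcases Nat.lt_succ_iff_lt_or_eq.1 hj with hj | rfl
        · exact Or.inl ⟨i, j, hij, hj, hi', hj'⟩
        · refine Or.inr ⟨hj', q i, Finset.mem_image_of_mem q (Finset.mem_range.2 (by omega)), ?_⟩
          rwa [sub_single_apply_of_ne (hne i (by omega))]

/-- The Betti numbers of the complement of a cycle of length `m` are linear except for one. -/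
def cycleBound (m i j : ℕ) : ℕ∞ :=
  if j = i + 2 then ⊤ else if i + 3 = m ∧ j = m then 1 else 0

lemma predBound_cyclePred_four (hq : Set.InjOn q (Set.Iio 4)) :
    PredBound K n (cyclePred q 4) (cycleBound 4) := by
  have h02 := ne_of_injOn hq (i := 0) (j := 2) (by omega) (by omega) (by omega)
  have h13 := ne_of_injOn hq (i := 1) (j := 3) (by omega) (by omega) (by omega)
  have h01 := ne_of_injOn hq (i := 0) (j := 1) (by omega) (by omega) (by omega)
  have h03 := ne_of_injOn hq (i := 0) (j := 3) (by omega) (by omega) (by omega)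
  have h12 := ne_of_injOn hq (i := 1) (j := 2) (by omega) (by omega) (by omega)
  have h23 := ne_of_injOn hq (i := 2) (j := 3) (by omega) (by omega) (by omega)
  refine PredBound.sup ((predBound_vars {q 2}).shift (q 0)) ((predBound_vars {q 3}).shift (q 1))
    ((((PredBound.true.shift (q 2)).shift (q 0)).shift (q 3)).shift (q 1)) ?_ ?_ ?_
  · intro α
    simp only [shiftPred, Finset.mem_singleton, exists_eq_left, sub_single_apply_of_ne h02.symm,
      sub_single_apply_of_ne h13.symm, sub_single_apply_of_ne h01, sub_single_apply_of_ne h03,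
      sub_single_apply_of_ne h12.symm, sub_single_apply_of_ne h23]
    tauto
  · intro α
    simp only [shiftPred, Finset.mem_singleton, exists_eq_left, sub_single_apply_of_ne h02.symm,
      sub_single_apply_of_ne h13.symm]
    constructor
    · rintro (⟨h, h'⟩ | ⟨h, h'⟩)
      · exact ⟨0, 2, by omega, by omega, by omega, h, h'⟩
      · exact ⟨1, 3, by omega, by omega, by omega, h, h'⟩
    · rintro ⟨i, j, hij, hj, hne, h, h'⟩
      obtain ⟨rfl, rfl⟩ | ⟨rfl, rfl⟩ : i = 0 ∧ j = 2 ∨ i = 1 ∧ j = 3 := by omega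
      · exact Or.inl ⟨h, h'⟩
      · exact Or.inr ⟨h, h'⟩
  · intro i j
    simp only [linBound, shiftBound, cycleBound]
    split_ifs <;> first | (exfalso; omega) | simp

lemma predBound_cyclePred {m : ℕ} (hm : 4 ≤ m) (hq : Set.InjOn q (Set.Iio m)) :
    PredBound K n (cyclePred q m) (cycleBound m) := by
  classical
  induction m, hm using Nat.le_induction with
  | base => exact predBound_cyclePred_four hq
  | succ m hm ih =>
    have hne : ∀ i < m, q i ≠ q m := fun i hi =>
      ne_of_injOn hq (by omega) (by omega) (by omega)
    have hq' : Set.InjOn q (Set.Iio m) := hq.mono fun i hi => Nat.lt_succ_of_lt hi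
    refine PredBound.sup (predBound_pathPred m hq')
      ((predBound_vars ((Finset.Icc 1 (m - 2)).image q)).shift (q m)) ((ih hq').shift (q m))
      ?_ ?_ ?_
    · intro α
      constructor
      · rintro ⟨⟨i, j, hij, hj, hi', hj'⟩, hv, u, hu, hu'⟩
        refine ⟨hv, ?_⟩
        rw [← sub_single_apply_of_ne (hne i (by omega))] at hi'
        rw [← sub_single_apply_of_ne (hne j hj)] at hj'
        obtain ⟨k, hk, rfl⟩ := Finset.mem_image.1 hu
        rw [Finset.mem_Icc] at hk
        by_cases h : i = 0 ∧ j + 1 = m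
        · obtain rfl := h.1
          rcases Nat.lt_or_ge k 2 with h2 | h2
          · obtain rfl : k = 1 := by omega
            exact ⟨1, j, by omega, hj, by omega, hu', hj'⟩
          · exact ⟨0, k, by omega, by omega, by omega, hi', hu'⟩
        · exact ⟨i, j, hij, hj, h, hi', hj'⟩
      · rintro ⟨hv, i, j, hij, hj, h, hi', hj'⟩
        refine ⟨⟨i, j, hij, hj, ?_, ?_⟩, hv, ?_⟩
        · rwa [sub_single_apply_of_ne (hne i (by omega))] at hi'
        · rwa [sub_single_apply_of_ne (hne j hj)] at hj'
        · rcases Nat.eq_zero_or_pos i with h0 | h0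
          · exact ⟨q j, Finset.mem_image_of_mem q (Finset.mem_Icc.2 (by omega)), hj'⟩
          · exact ⟨q i, Finset.mem_image_of_mem q (Finset.mem_Icc.2 (by omega)), hi'⟩
    · intro α
      constructor
      · rintro (⟨i, j, hij, hj, h⟩ | ⟨hv, u, hu, h⟩)
        · exact ⟨i, j, hij, by omega, by omega, h⟩
        · obtain ⟨i, hi, rfl⟩ := Finset.mem_image.1 hu
          rw [Finset.mem_Icc] at hi
          rw [sub_single_apply_of_ne (hne i (by omega))] at h
          exact ⟨i, m, by omega, by omega, by omega, h, hv⟩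
      · rintro ⟨i, j, hij, hj, h, hi', hj'⟩
        rcases Nat.lt_succ_iff_lt_or_eq.1 hj with hj | rfl
        · exact Or.inl ⟨i, j, hij, hj, hi', hj'⟩
        · refine Or.inr ⟨hj', q i, Finset.mem_image_of_mem q (Finset.mem_Icc.2 (by omega)), ?_⟩
          rwa [sub_single_apply_of_ne (hne i (by omega))]
    · intro i j
      simp only [linBound, shiftBound, cycleBound]
      split_ifs <;> first | (exfalso; omega) | simp

end Cycle

section Dirac

variable {n : ℕ} {G : SimpleGraph (Fin n)}

/-- The complement of `G`, restricted to `A`. -/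
def complOn (G : SimpleGraph (Fin n)) (A : Set (Fin n)) : SimpleGraph (Fin n) where
  Adj a b := a ≠ b ∧ ¬ G.Adj a b ∧ a ∈ A ∧ b ∈ A
  symm := ⟨fun _ _ h => ⟨h.1.symm, fun e => h.2.1 e.symm, h.2.2.2, h.2.2.1⟩⟩
  loopless := ⟨fun _ h => h.1 rfl⟩

/-- Closing an induced path of the complement by a vertex. -/
lemma isAnticycle_of_path {p : ℕ → Fin n} {k : ℕ} {v : Fin n} (hk : 2 ≤ k)
    (hinj : ∀ i j, i < j → j ≤ k → p i ≠ p j)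
    (hp : ∀ i j, i < j → j ≤ k → (¬ G.Adj (p i) (p j) ↔ j = i + 1))
    (hv : ∀ i ≤ k, p i ≠ v) (hv' : ∀ i ≤ k, (¬ G.Adj (p i) v ↔ i = 0 ∨ i = k)) :
    ∃ q, IsAnticycle G (k + 2) q := by
  have e1 : ∀ i ≤ k, (if i ≤ k then p i else if i = k + 1 then v else p 0) = p i :=
    fun i hi => if_pos hi
  have e2 : (if k + 1 ≤ k then p (k + 1) else if k + 1 = k + 1 then v else p 0) = v := by simp
  have hne : ∀ i j, i < j → j < k + 2 → (if i ≤ k then p i else if i = k + 1 then v else p 0) ≠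
      (if j ≤ k then p j else if j = k + 1 then v else p 0) := by
    intro i j hij hj
    rcases Nat.lt_or_ge k j with h | h
    · obtain rfl : j = k + 1 := by omega
      rw [e2, e1 i (by omega)]
      exact hv i (by omega)
    · rw [e1 i (by omega), e1 j h]
      exact hinj i j hij h
  refine ⟨fun i => if i ≤ k then p i else if i = k + 1 then v else p 0, by omega, ?_, ?_, ?_⟩
  · simp
  · intro i hi j hj hij
    rcases lt_trichotomy i j with h | h | h
    · exact absurd hij (hne i j h hj)
    · exact h
    · exact absurd hij.symm (hne j i h hi)
  · intro i j hij hj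
    rcases Nat.lt_or_ge k j with h | h
    · obtain rfl : j = k + 1 := by omega
      rw [e2, e1 i (by omega), hv' i (by omega)]
      omega
    · rw [e1 i (by omega), e1 j h, hp i j hij h]
      omega

/-- Two common neighbours of `v` and of a component of the non-neighbours of `v` are adjacent in
the complement, if the complement has no long induced cycles. -/
lemma not_adj_of_reachable (hG : ∀ m q, ¬ IsAnticycle G m q) {C : Set (Fin n)} {v x y b b' : Fin n}
    (hC : ∀ c ∈ C, c ≠ v ∧ G.Adj c v) (hx : ¬ G.Adj x v) (hxv : x ≠ v) (hy : ¬ G.Adj y v)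
    (hyv : y ≠ v) (hb : b ∈ C) (hb' : b' ∈ C) (hbb' : (complOn G C).Reachable b b')
    (hxb : ¬ G.Adj x b) (hyb : ¬ G.Adj y b') : ¬ G.Adj x y := by
  intro hadj
  let A : Set (Fin n) := C ∪ {x, y}
  have hCA : complOn G C ≤ complOn G A := fun a c h => ⟨h.1, h.2.1, Or.inl h.2.2.1, Or.inl h.2.2.2⟩
  have hxA : x ∈ A := Or.inr (Or.inl rfl)
  have hyA : y ∈ A := Or.inr (Or.inr rfl)
  have h1 : (complOn G A).Adj x b :=
    ⟨fun e => hx (e ▸ (hC b hb).2), hxb, hxA, Or.inl hb⟩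
  have h2 : (complOn G A).Adj y b' :=
    ⟨fun e => hy (e ▸ (hC b' hb').2), hyb, hyA, Or.inl hb'⟩
  have hr : (complOn G A).Reachable x y :=
    h1.reachable.trans ((hbb'.mono hCA).trans h2.symm.reachable)
  obtain ⟨w, hw⟩ := hr.exists_walk_length_eq_dist
  have hsucc : ∀ i < w.length, (complOn G A).Adj (w.getVert i) (w.getVert (i + 1)) :=
    fun i hi => w.adj_getVert_succ hi
  have hshort : ∀ i j, i ≤ j → j ≤ w.length →
      ∀ u : (complOn G A).Walk (w.getVert i) (w.getVert j), j ≤ i + u.length := by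
    intro i j hij hj u
    have := SimpleGraph.dist_le ((w.take i).append (u.append (w.drop j)))
    rw [SimpleGraph.Walk.length_append, SimpleGraph.Walk.length_append,
      SimpleGraph.Walk.take_length, SimpleGraph.Walk.drop_length, ← hw] at this
    omega
  have hinj : ∀ i j, i < j → j ≤ w.length → w.getVert i ≠ w.getVert j := by
    intro i j hij hj e
    have := hshort i j hij.le hj (SimpleGraph.Walk.nil.copy rfl e)
    rw [SimpleGraph.Walk.length_copy, SimpleGraph.Walk.length_nil] at this
    omega
  have hxy : x ≠ y := hadj.ne
  have hk : 2 ≤ w.length := by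
    by_contra hlt
    have h0 := w.getVert_zero
    have hl := w.getVert_length
    rcases Nat.eq_zero_or_pos w.length with h | h
    · rw [h] at hl
      exact hxy (h0.symm.trans hl)
    · have := hsucc 0 h
      rw [show 0 + 1 = w.length by omega, hl, h0] at this
      exact this.2.1 hadj
  have hmem : ∀ i ≤ w.length, w.getVert i ∈ A := by
    intro i hi
    rcases hi.lt_or_eq with h | rfl
    · exact (hsucc i h).2.2.1
    · rw [w.getVert_length]
      exact hyA
  have hmid : ∀ i, 0 < i → i < w.length → w.getVert i ∈ C := by
    intro i h0 hi
    rcases hmem i hi.le with h | h | h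
    · exact h
    · exact absurd (w.getVert_zero.trans h.symm) (hinj 0 i h0 hi.le)
    · exact absurd (Eq.trans h w.getVert_length.symm) (hinj i _ hi le_rfl)
  refine (isAnticycle_of_path (G := G) (p := w.getVert) (v := v) hk hinj ?_ ?_ ?_).elim (hG _)
  · intro i j hij hj
    constructor
    · intro h
      have hadj' : (complOn G A).Adj (w.getVert i) (w.getVert j) :=
        ⟨hinj i j hij hj, h, hmem i (by omega), hmem j hj⟩
      have := hshort i j hij.le hj hadj'.toWalk
      rw [SimpleGraph.Adj.length_toWalk] at this
      omega
    · rintro rfl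
      exact (hsucc i (by omega)).2.1
  · intro i hi
    rcases hmem i hi with h | h | h
    · exact (hC _ h).1
    · rw [h]; exact hxv
    · rw [h]; exact hyv
  · intro i hi
    constructor
    · intro h
      by_contra! hne
      exact h (hC _ (hmid i (by omega) (by omega))).2
    · rintro (rfl | rfl)
      · rwa [w.getVert_zero]
      · rwa [w.getVert_length]

/-- Dirac's theorem on simplicial vertices of chordal graphs. -/
lemma exists_isCosimplicial_of_adj (hG : ∀ m q, ¬ IsAnticycle G m q) (V : Finset (Fin n)) :
    ∀ v ∈ V, (∃ w ∈ V, G.Adj v w) → ∃ u, IsCosimplicial G V u ∧ G.Adj v u := by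
  classical
  induction V using Finset.strongInduction with
  | H V ih =>
    rintro v hv ⟨b₀, hb₀, hvb₀⟩
    let C : Set (Fin n) := {c | c ∈ V ∧ G.Adj c v}
    let B : Finset (Fin n) := V.filter fun b => G.Adj b v ∧ (complOn G C).Reachable b₀ b
    let S : Finset (Fin n) :=
      V.filter fun s => s ≠ v ∧ ¬ G.Adj s v ∧ ∃ b ∈ B, ¬ G.Adj s b
    have hB : ∀ b ∈ B, b ∈ V ∧ G.Adj b v ∧ (complOn G C).Reachable b₀ b :=
      fun b hb => Finset.mem_filter.1 hb
    have hS : ∀ s ∈ S, s ∈ V ∧ s ≠ v ∧ ¬ G.Adj s v ∧ ∃ b ∈ B, ¬ G.Adj s b :=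
      fun s hs => Finset.mem_filter.1 hs
    have hb₀B : b₀ ∈ B := Finset.mem_filter.2 ⟨hb₀, hvb₀.symm, SimpleGraph.Reachable.refl _⟩
    have hSS : ∀ s ∈ S, ∀ s' ∈ S, ¬ G.Adj s s' := by
      intro s hs s' hs'
      obtain ⟨-, h1, h2, b, hb, hsb⟩ := hS s hs
      obtain ⟨-, h1', h2', b', hb', hsb'⟩ := hS s' hs'
      obtain ⟨hbV, hbv, hbr⟩ := hB b hb
      obtain ⟨hbV', hbv', hbr'⟩ := hB b' hb'
      exact not_adj_of_reachable hG (C := C) (fun c hc => ⟨hc.2.ne, hc.2⟩) h2 h1 h2' h1'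
        ⟨hbV, hbv⟩ ⟨hbV', hbv'⟩ (hbr.symm.trans hbr') hsb hsb'
    have hnbr : ∀ b ∈ B, ∀ u ∈ V, ¬ G.Adj b u → u ∈ B ∪ S := by
      intro b hb u hu hbu
      obtain ⟨hbV, hbv, hbr⟩ := hB b hb
      rw [Finset.mem_union]
      by_cases huv : G.Adj u v
      · refine Or.inl (Finset.mem_filter.2 ⟨hu, huv, ?_⟩)
        by_cases h : b = u
        · exact h ▸ hbr
        · exact hbr.trans (SimpleGraph.Adj.reachable ⟨h, hbu, ⟨hbV, hbv⟩, hu, huv⟩)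
      · exact Or.inr (Finset.mem_filter.2 ⟨hu, fun e => hbu (e ▸ hbv), huv, b, hb,
          fun e => hbu e.symm⟩)
    have hlift : ∀ b ∈ B, IsCosimplicial G (B ∪ S) b → ∃ u, IsCosimplicial G V u ∧ G.Adj v u := by
      intro b hb hsimp
      refine ⟨b, ⟨(hB b hb).1, fun u hu w hw h1 h2 h3 h4 => ?_⟩, (hB b hb).2.1.symm⟩
      exact hsimp.2 u (hnbr b hb u hu h3) w (hnbr b hb w hw h4) h1 h2 h3 h4
    have hsub : B ∪ S ⊂ V := by
      refine Finset.ssubset_iff_subset_ne.2 ⟨Finset.union_subset (Finset.filter_subset _ _)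
        (Finset.filter_subset _ _), fun e => ?_⟩
      have hv' := hv
      rw [← e, Finset.mem_union] at hv'
      rcases hv' with h | h
      · exact (hB v h).2.1.ne rfl
      · exact (hS v h).2.1 rfl
    by_cases hs : ∃ s ∈ S, ∃ w ∈ B ∪ S, G.Adj s w
    · obtain ⟨s, hs, hw⟩ := hs
      obtain ⟨u, hu, hsu⟩ := ih _ hsub s (Finset.mem_union_right _ hs) hw
      rcases Finset.mem_union.1 hu.1 with h | h
      · exact hlift u h hu
      · exact absurd hsu (hSS s hs u h)
    · by_cases hb : ∃ b ∈ B, ∃ w ∈ B ∪ S, G.Adj b w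
      · obtain ⟨b, hb, hw⟩ := hb
        obtain ⟨u, hu, hbu⟩ := ih _ hsub b (Finset.mem_union_left _ hb) hw
        rcases Finset.mem_union.1 hu.1 with h | h
        · exact hlift u h hu
        · exact absurd ⟨u, h, b, Finset.mem_union_left _ hb, hbu.symm⟩ hs
      · refine hlift b₀ hb₀B ⟨Finset.mem_union_left _ hb₀B, fun u hu w hw _ _ _ _ huw => ?_⟩
        rcases Finset.mem_union.1 hu with h | h
        · exact hb ⟨u, h, w, hw, huw⟩
        · exact hs ⟨u, h, w, hw, huw⟩

lemma exists_isCosimplicial (hG : ∀ m q, ¬ IsAnticycle G m q) {V : Finset (Fin n)}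
    (hV : V.Nonempty) : ∃ v, IsCosimplicial G V v := by
  by_cases h : ∃ v ∈ V, ∃ w ∈ V, G.Adj v w
  · obtain ⟨v, hv, hw⟩ := h
    obtain ⟨u, hu, -⟩ := exists_isCosimplicial_of_adj hG V v hv hw
    exact ⟨u, hu⟩
  · obtain ⟨v, hv⟩ := hV
    exact ⟨v, hv, fun u hu w hw _ _ _ _ huw => h ⟨u, hu, w, hw, huw⟩⟩

end Dirac

lemma linBound_eq_zero {c i j : ℕ} (h : j ≠ i + c) : linBound c i j = 0 := if_neg h

/-- Fröberg's theorem, in terms of the index. -/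
lemma idealIndex_eq_top {K : Type} [Field K] {n : ℕ} {G : SimpleGraph (Fin n)}
    (hG : ∀ m q, ¬ IsAnticycle G m q) : idealIndex (edgeIdeal K G.Adj) 2 = ⊤ := by
  have hb := predBound_edgePred (K := K) (fun V hV => exists_isCosimplicial hG hV) Finset.univ
  have hle := hb.gradedBetti_le (G := G) (fun α => by simp [edgePred])
  rw [ENat.eq_top_iff_forall_ge]
  intro r
  refine le_trans le_self_add (le_sSup (a := (r : ℕ∞) + 1) ⟨r, rfl, fun i _ j hj => ?_⟩)
  refine le_antisymm ((hle i (i + j)).trans_eq (linBound_eq_zero (by omega))) zero_le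

lemma IsAnticycle.cyclePred_iff {n : ℕ} {G : SimpleGraph (Fin n)} {q : ℕ → Fin n}
    (h : IsAnticycle G n q) (α : Fin n →₀ ℕ) :
    cyclePred q n α ↔ ∃ i j, G.Adj i j ∧ α i ≠ 0 ∧ α j ≠ 0 := by
  have hsurj : ∀ v, ∃ i < n, q i = v := by
    intro v
    have huniv : (Finset.range n).image q = Finset.univ :=
      (Finset.card_eq_iff_eq_univ _).1 (h.card_image.trans (Fintype.card_fin n).symm)
    obtain ⟨i, hi, e⟩ := Finset.mem_image.1 (huniv ▸ Finset.mem_univ v)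
    exact ⟨i, Finset.mem_range.1 hi, e⟩
  have key : ∀ i j, i < j → j < n → G.Adj (q i) (q j) → i + 2 ≤ j ∧ ¬ (i = 0 ∧ j + 1 = n) := by
    intro i j hij hj hadj
    have := mt (h.not_adj_iff i j hij hj).2 (not_not.2 hadj)
    omega
  constructor
  · rintro ⟨i, j, hij, hj, hne, h1, h2⟩
    exact ⟨q i, q j, h.adj hij hj hne, h1, h2⟩
  · rintro ⟨u, w, hadj, h1, h2⟩
    obtain ⟨i, hi, rfl⟩ := hsurj u
    obtain ⟨j, hj, rfl⟩ := hsurj w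
    rcases lt_trichotomy i j with hij | rfl | hij
    · obtain ⟨h3, h4⟩ := key i j hij hj hadj
      exact ⟨i, j, h3, hj, h4, h1, h2⟩
    · exact absurd rfl hadj.ne
    · obtain ⟨h3, h4⟩ := key j i hij hi hadj.symm
      exact ⟨j, i, h3, hi, h4, h2, h1⟩

/-- **Proposition.** If the edge ideal `I` of a simple graph `G` on `[n]` without
isolated vertices has `index(I) = projdim(I) = t` (finite), then `n = t+3` and
`β_{t,t+3}(I) = 1`. -/
theorem stmt8 (K : Type) [Field K] (n : ℕ) (G : SimpleGraph (Fin n))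
    (hiso : ∀ a : Fin n, ∃ b, G.Adj a b)
    (I : Ideal (SRing K n)) (hI : I = edgeIdeal K G.Adj) (t : ℕ)
    (hind : idealIndex I 2 = (t : ℕ∞)) (hpd : projDim I = (t : ℕ∞)) :
    n = t + 3 ∧ gradedBetti I t (t+3) = 1 := by
  subst hI
  obtain ⟨R, hR⟩ := exists_resolution_of_projDim_eq hpd
  by_cases hG : ∀ m q, ¬ IsAnticycle G m q
  · rw [idealIndex_eq_top hG] at hind
    exact absurd hind.symm (ENat.natCast_ne_top t)
  · push Not at hG
    obtain ⟨m, q, hq⟩ := hG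
    have hm := hq.eq_add_three hind R hR
    obtain rfl := hq.card_eq hiso hind R hR
    refine ⟨hm, le_antisymm ?_ (hq.one_le_gradedBetti hm)⟩
    refine ((predBound_cyclePred hq.four_le hq.inj).gradedBetti_le hq.cyclePred_iff _ _).trans ?_
    rw [cycleBound, if_neg (by omega)]
    split_ifs
    · exact le_rfl
    · exact zero_le

end
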